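/- For every ε > 0 there exists a constant C = C(ε) > 0 such that for all positive integers m and n, f₅(m,n) ≤ C · n^ε · (n²/m)^(28/17). -/

import Mathlib

/-- `numSols k m n` is the number of nondecreasing `k`-tuples of positive integers
`(a₁, …, a_k)` with `m / n = 1/a₁ + ⋯ + 1/a_k`. -/
noncomputable def numSols (k m n : ℕ) : ℕ :=
  Nat.card {a : Fin k → ℕ // (∀ i, 0 < a i) ∧ Monotone a ∧
    (m : ℚ) / n = ∑ i, (1 : ℚ) / a i}


/-- `Bd S K`: every finite subset of `S` has at most `K` elements. -/
def Bd {α : Type} (S : Set α) (K : ℝ) : Prop :=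
  ∀ F : Finset α, (∀ x ∈ F, x ∈ S) → (F.card : ℝ) ≤ K

lemma Bd.mono {α : Type} {S T : Set α} {K L : ℝ} (h : Bd T K) (hST : ∀ x ∈ S, x ∈ T)
    (hKL : K ≤ L) : Bd S L :=
  fun F hF => (h F fun x hx => hST x (hF x hx)).trans hKL

lemma Bd.union {α : Type} {S T U : Set α} {K L : ℝ} (hS : Bd S K) (hT : Bd T L)
    (h : ∀ x ∈ U, x ∈ S ∨ x ∈ T) : Bd U (K + L) := by
  classical
  intro F hF
  have h1 := hS (F.filter (· ∈ S)) (by intro x hx; exact (Finset.mem_filter.1 hx).2)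
  have h2 := hT (F.filter (· ∉ S)) (by
    intro x hx
    have := Finset.mem_filter.1 hx
    exact (h x (hF x this.1)).resolve_left this.2)
  have h3 := Finset.card_filter_add_card_filter_not (s := F) (· ∈ S)
  have h4 : ((F.filter (· ∈ S)).card : ℝ) + (F.filter (· ∉ S)).card = F.card := by
    exact_mod_cast h3
  linarith

lemma Bd.fiber {α β : Type} {S : Set α} (f : α → β) (I : Finset β) (K : β → ℝ)
    (hf : ∀ x ∈ S, f x ∈ I) (h : ∀ i ∈ I, Bd {x | x ∈ S ∧ f x = i} (K i)) :
    Bd S (∑ i ∈ I, K i) := by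
  classical
  intro F hF
  have h1 := Finset.card_eq_sum_card_fiberwise (s := F) (t := I) (f := f)
    (fun x hx => hf x (hF x hx))
  rw [h1]
  push_cast
  apply Finset.sum_le_sum
  intro i hi
  apply h i hi
  intro x hx
  have := Finset.mem_filter.1 hx
  exact ⟨hF x this.1, this.2⟩

lemma Bd.fiber_const {α β : Type} {S : Set α} (f : α → β) (I : Finset β) {K L : ℝ}
    (hf : ∀ x ∈ S, f x ∈ I) (hI : (I.card : ℝ) ≤ L) (hK : 0 ≤ K)
    (h : ∀ i ∈ I, Bd {x | x ∈ S ∧ f x = i} K) :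
    Bd S (L * K) := by
  have := Bd.fiber f I (fun _ => K) hf h
  refine this.mono (fun x hx => hx) ?_
  rw [Finset.sum_const, nsmul_eq_mul]
  gcongr

lemma Bd.subsingleton {α : Type} {S : Set α} (h : ∀ x ∈ S, ∀ y ∈ S, x = y) : Bd S 1 := by
  intro F hF
  have : F.card ≤ 1 := Finset.card_le_one.2 fun x hx y hy => h x (hF x hx) y (hF y hy)
  exact_mod_cast this

lemma Bd.inj {α β : Type} {S : Set α} {T : Set β} {K : ℝ} (f : α → β) (h : Bd T K)
    (hf : ∀ x ∈ S, f x ∈ T) (hi : ∀ x ∈ S, ∀ y ∈ S, f x = f y → x = y) : Bd S K := by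
  classical
  intro F hF
  have h1 := h (F.image f) (by
    intro y hy
    obtain ⟨x, hx, rfl⟩ := Finset.mem_image.1 hy
    exact hf x (hF x hx))
  rwa [Finset.card_image_of_injOn (fun x hx y hy hxy => hi x (hF x hx) y (hF y hy) hxy)] at h1

lemma Bd.image {α β : Type} [Nonempty β] {S : Set α} {T : Set β} {K : ℝ} (g : β → α) (h : Bd T K)
    (hg : ∀ x ∈ S, ∃ y ∈ T, g y = x) : Bd S K := by
  classical
  choose! f hf using hg
  refine Bd.inj f h (fun x hx => (hf x hx).1) ?_
  intro x hx y hy hxy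
  rw [← (hf x hx).2, hxy, (hf y hy).2]

/-- Divisor bound. -/
lemma divisor_bound (ε : ℝ) (hε : 0 < ε) : ∃ C : ℝ, 1 ≤ C ∧ ∀ n : ℕ, n ≠ 0 →
    (n.divisors.card : ℝ) ≤ C * (n : ℝ) ^ ε := by
  set P : ℕ := ⌈(2 : ℝ) ^ (1 / ε)⌉₊ with hP
  have hl : 0 < Real.log 2 := Real.log_pos (by norm_num)
  set K : ℝ := max 1 (1 / (ε * Real.log 2)) with hKdef
  have hK1 : 1 ≤ K := le_max_left _ _
  have hK2 : 1 ≤ K * (ε * Real.log 2) := by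
    have : 1 / (ε * Real.log 2) ≤ K := le_max_right _ _
    rwa [div_le_iff₀ (by positivity)] at this
  refine ⟨K ^ P, one_le_pow₀ hK1, fun n hn => ?_⟩
  have hp : ∀ p ∈ n.primeFactors, ((n.factorization p + 1 : ℕ) : ℝ) ≤
      (if p < P then K else 1) * ((p : ℝ) ^ (n.factorization p)) ^ ε := by
    intro p hp
    have hpp := Nat.prime_of_mem_primeFactors hp
    have hp2 : (2 : ℝ) ≤ p := by exact_mod_cast hpp.two_le
    set e := n.factorization p
    split_ifs with h
    · have h1 : ((2 : ℝ) ^ e) ^ ε ≤ ((p : ℝ) ^ e) ^ ε := by gcongr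
      have h2 : ((2 : ℝ) ^ e) ^ ε = Real.exp (e * (ε * Real.log 2)) := by
        rw [Real.rpow_def_of_pos (by positivity), Real.log_pow]
        ring_nf
      have h3 := Real.add_one_le_exp (e * (ε * Real.log 2))
      have he : (0 : ℝ) ≤ e := Nat.cast_nonneg _
      calc ((e + 1 : ℕ) : ℝ) = e * 1 + 1 := by push_cast; ring
        _ ≤ e * (K * (ε * Real.log 2)) + K := by gcongr
        _ = K * (e * (ε * Real.log 2) + 1) := by ring
        _ ≤ K * ((p : ℝ) ^ e) ^ ε := by rw [h2] at h1; gcongr; linarith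
    · have h1 : (2 : ℝ) ^ (1 / ε) ≤ p := (Nat.le_ceil _).trans (by exact_mod_cast not_lt.1 h)
      have h2 : (2 : ℝ) ≤ (p : ℝ) ^ ε := by
        calc (2 : ℝ) = ((2 : ℝ) ^ (1 / ε)) ^ ε := by
              rw [← Real.rpow_mul (by norm_num)]; field_simp; simp
          _ ≤ _ := by gcongr
      have h3 : ((p : ℝ) ^ e) ^ ε = ((p : ℝ) ^ ε) ^ e := by
        rw [← Real.rpow_natCast, ← Real.rpow_natCast, ← Real.rpow_mul (by positivity),
          ← Real.rpow_mul (by positivity), mul_comm]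
      rw [one_mul, h3]
      have h4 : e + 1 ≤ 2 ^ e := Nat.lt_two_pow_self
      calc ((e + 1 : ℕ) : ℝ) ≤ ((2 ^ e : ℕ) : ℝ) := by exact_mod_cast h4
        _ = (2 : ℝ) ^ e := by push_cast; ring
        _ ≤ _ := by gcongr
  rw [Nat.card_divisors hn]
  push_cast
  calc ∏ p ∈ n.primeFactors, ((n.factorization p : ℝ) + 1)
      ≤ ∏ p ∈ n.primeFactors, ((if p < P then K else 1) *
          ((p : ℝ) ^ (n.factorization p)) ^ ε) := by
        apply Finset.prod_le_prod
        · intros; positivity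
        · intro p h; have := hp p h; push_cast at this; exact this
    _ = (∏ p ∈ n.primeFactors, (if p < P then K else 1)) *
          (∏ p ∈ n.primeFactors, (p : ℝ) ^ (n.factorization p)) ^ ε := by
        rw [Finset.prod_mul_distrib, Real.finsetProd_rpow]
        intros; positivity
    _ ≤ K ^ P * (n : ℝ) ^ ε := by
        have h1 : ∏ p ∈ n.primeFactors, (p : ℝ) ^ (n.factorization p) = n := by
          conv_rhs => rw [← Nat.prod_factorization_pow_eq_self hn]
          rw [Finsupp.prod, Nat.support_factorization]
          push_cast; rfl
        rw [h1]
        gcongr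
        rw [← Finset.prod_filter, Finset.prod_const]
        apply pow_le_pow_right₀ hK1
        calc _ ≤ (Finset.range P).card := by
              apply Finset.card_le_card
              intro p hp
              exact Finset.mem_range.2 (Finset.mem_filter.1 hp).2
          _ = P := Finset.card_range P

/-- structure -/
def Sol3 (m n a b c : ℕ) : Prop :=
  0 < a ∧ 0 < b ∧ 0 < c ∧ m * (a * b * c) = n * (b * c + a * c + a * b)

lemma dvd_lcm_aux {m A B C s t u : ℕ} (ht : 0 < t) (hu : 0 < u)
    (hcop : Nat.Coprime s A)
    (h : m * (s * t * u) = A * (t * u) + B * (s * u) + C * (s * t)) : s ∣ Nat.lcm t u := by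
  obtain ⟨p, hp⟩ := Nat.dvd_lcm_left t u
  obtain ⟨q, hq⟩ := Nat.dvd_lcm_right t u
  set l := Nat.lcm t u
  have h1 : m * (s * l) = A * l + B * (s * p) + C * (s * q) := by
    have : (t * u) * (m * (s * l)) = (t * u) * (A * l + B * (s * p) + C * (s * q)) := by
      calc (t * u) * (m * (s * l)) = (m * (s * t * u)) * l := by ring
        _ = A * (t * u) * l + B * (s * u) * l + C * (s * t) * l := by rw [h]; ring
        _ = A * (t * u) * l + B * (s * u) * (t * p) + C * (s * t) * (u * q) := by
            rw [← hp, ← hq]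
        _ = _ := by ring
    exact Nat.eq_of_mul_eq_mul_left (by positivity) this
  have h2 : s ∣ A * l := by
    have h3 : s ∣ A * l + s * (B * p + C * q) :=
      ⟨m * l, by linarith⟩
    exact (Nat.dvd_add_left (dvd_mul_right _ _)).1 h3
  exact hcop.dvd_of_dvd_mul_left h2

lemma gcd_mul_aux {s t u : ℕ} (h : s ∣ Nat.lcm t u) :
    Nat.gcd s t * Nat.gcd s u = s * Nat.gcd (Nat.gcd s t) u := by
  apply Nat.dvd_antisymm
  · have e1 : s * Nat.gcd (Nat.gcd s t) u = Nat.gcd (Nat.gcd (s * s) (s * t)) (s * u) := by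
      rw [Nat.gcd_mul_left, Nat.gcd_mul_left]
    rw [e1]
    refine Nat.dvd_gcd (Nat.dvd_gcd ?_ ?_) ?_
    · exact mul_dvd_mul (Nat.gcd_dvd_left _ _) (Nat.gcd_dvd_left _ _)
    · rw [mul_comm]; exact mul_dvd_mul (Nat.gcd_dvd_left _ _) (Nat.gcd_dvd_right _ _)
    · exact mul_dvd_mul (Nat.gcd_dvd_left _ _) (Nat.gcd_dvd_right _ _)
  · have e1 : Nat.gcd s t * Nat.gcd s u =
        Nat.gcd (Nat.gcd (s * s) (t * s)) (Nat.gcd (s * u) (t * u)) := by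
      rw [Nat.gcd_mul_right, Nat.gcd_mul_right, Nat.gcd_mul_left]
    have d1 : Nat.gcd (Nat.gcd s t) u ∣ s := (Nat.gcd_dvd_left _ _).trans (Nat.gcd_dvd_left _ _)
    have d2 : Nat.gcd (Nat.gcd s t) u ∣ t := (Nat.gcd_dvd_left _ _).trans (Nat.gcd_dvd_right _ _)
    have d3 : Nat.gcd (Nat.gcd s t) u ∣ u := Nat.gcd_dvd_right _ _
    rw [e1]
    refine Nat.dvd_gcd (Nat.dvd_gcd ?_ ?_) (Nat.dvd_gcd ?_ ?_)
    · exact mul_dvd_mul dvd_rfl d1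
    · rw [mul_comm t]; exact mul_dvd_mul dvd_rfl d2
    · exact mul_dvd_mul dvd_rfl d3
    · rw [← Nat.gcd_mul_lcm t u, mul_comm]
      exact mul_dvd_mul (Nat.dvd_gcd d2 d3) h

/-- The structure of solutions. -/
lemma sol3_struct {m n a b c : ℕ} (h : Sol3 m n a b c) :
    ∃ w x y z : ℕ, 0 < w ∧ 0 < x ∧ 0 < y ∧ 0 < z ∧
      a = Nat.gcd a n * (w * y * z) ∧ b = Nat.gcd b n * (w * x * z) ∧
      c = Nat.gcd c n * (w * x * y) ∧
      m * (w * x * y * z) = n / Nat.gcd a n * x + n / Nat.gcd b n * y + n / Nat.gcd c n * z := by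
  obtain ⟨ha, hb, hc, h⟩ := h
  have key : ∀ a : ℕ, 0 < a → ∃ t A, 0 < t ∧ a = Nat.gcd a n * t ∧ n = Nat.gcd a n * A ∧
      A = n / Nat.gcd a n ∧ Nat.Coprime t A := by
    intro a ha
    have hg : 0 < Nat.gcd a n := Nat.gcd_pos_of_pos_left _ ha
    refine ⟨a / Nat.gcd a n, n / Nat.gcd a n, ?_, ?_, ?_, rfl, ?_⟩
    · exact Nat.div_pos (Nat.gcd_le_left _ ha) hg
    · exact (Nat.mul_div_cancel' (Nat.gcd_dvd_left _ _)).symm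
    · exact (Nat.mul_div_cancel' (Nat.gcd_dvd_right _ _)).symm
    · exact Nat.coprime_div_gcd_div_gcd hg
  obtain ⟨s, A, hs, has, hnA, hA, cs⟩ := key a ha
  obtain ⟨t, B, ht, hbt, hnB, hB, ct⟩ := key b hb
  obtain ⟨u, C, hu, hcu, hnC, hC, cu⟩ := key c hc
  rw [← hA, ← hB, ← hC]
  set p := Nat.gcd a n
  set q := Nat.gcd b n
  set r := Nat.gcd c n
  have hp : 0 < p := Nat.pos_of_ne_zero (by rintro h; simp [h] at has; omega)
  have hq : 0 < q := Nat.pos_of_ne_zero (by rintro h; simp [h] at hbt; omega)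
  have hr : 0 < r := Nat.pos_of_ne_zero (by rintro h; simp [h] at hcu; omega)
  have eq1 : m * (s * t * u) = A * (t * u) + B * (s * u) + C * (s * t) := by
    have : (p * q * r) * (m * (s * t * u)) =
        (p * q * r) * (A * (t * u) + B * (s * u) + C * (s * t)) := by
      calc (p * q * r) * (m * (s * t * u)) = m * ((p * s) * (q * t) * (r * u)) := by ring
        _ = m * (a * b * c) := by rw [← has, ← hbt, ← hcu]
        _ = n * (b * c) + n * (a * c) + n * (a * b) := by rw [h]; ring
        _ = (p * A) * ((q * t) * (r * u)) + (q * B) * ((p * s) * (r * u))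
            + (r * C) * ((p * s) * (q * t)) := by
            rw [← has, ← hbt, ← hcu, ← hnA, ← hnB, ← hnC]
        _ = _ := by ring
    exact Nat.eq_of_mul_eq_mul_left (by positivity) this
  have l1 : s ∣ Nat.lcm t u := dvd_lcm_aux ht hu cs eq1
  have l2 : t ∣ Nat.lcm s u := by
    refine dvd_lcm_aux (m := m) (A := B) (B := A) (C := C) hs hu ct ?_
    linarith
  have l3 : u ∣ Nat.lcm s t := by
    refine dvd_lcm_aux (m := m) (A := C) (B := A) (C := B) hs ht cu ?_
    linarith
  have g1 := gcd_mul_aux l1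
  have g2 := gcd_mul_aux l2
  have g3 := gcd_mul_aux l3
  obtain ⟨w, hw⟩ : ∃ w, w = Nat.gcd (Nat.gcd s t) u := ⟨_, rfl⟩
  have hw0 : 0 < w := by rw [hw]; exact Nat.gcd_pos_of_pos_right _ hu
  obtain ⟨z, hz⟩ : w ∣ Nat.gcd s t := hw ▸ Nat.gcd_dvd_left _ _
  obtain ⟨y, hy⟩ : w ∣ Nat.gcd s u := hw ▸ Nat.dvd_gcd
    ((Nat.gcd_dvd_left _ _).trans (Nat.gcd_dvd_left _ _)) (Nat.gcd_dvd_right _ _)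
  obtain ⟨x, hx⟩ : w ∣ Nat.gcd t u := hw ▸ Nat.dvd_gcd
    ((Nat.gcd_dvd_left _ _).trans (Nat.gcd_dvd_right _ _)) (Nat.gcd_dvd_right _ _)
  have w2 : Nat.gcd (Nat.gcd t s) u = w := by rw [Nat.gcd_comm t s, hw]
  have w3 : Nat.gcd (Nat.gcd u s) t = w := by
    rw [hw, Nat.gcd_comm u s, Nat.gcd_assoc, Nat.gcd_assoc, Nat.gcd_comm u t]
  rw [← hw, hz, hy] at g1
  rw [w2, Nat.gcd_comm t s, hz, hx] at g2
  rw [w3, Nat.gcd_comm u s, Nat.gcd_comm u t, hy, hx] at g3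
  have s1 : s = w * y * z := Nat.eq_of_mul_eq_mul_right hw0 (by rw [← g1]; ring)
  have t1 : t = w * x * z := Nat.eq_of_mul_eq_mul_right hw0 (by rw [← g2]; ring)
  have u1 : u = w * x * y := Nat.eq_of_mul_eq_mul_right hw0 (by rw [← g3]; ring)
  have hx0 : 0 < x := Nat.pos_of_ne_zero (by rintro rfl; simp at t1; omega)
  have hy0 : 0 < y := Nat.pos_of_ne_zero (by rintro rfl; simp at s1; omega)
  have hz0 : 0 < z := Nat.pos_of_ne_zero (by rintro rfl; simp at t1; omega)
  refine ⟨w, x, y, z, hw0, hx0, hy0, hz0, by rw [← s1]; exact has, by rw [← t1]; exact hbt,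
    by rw [← u1]; exact hcu, ?_⟩
  have : (w ^ 2 * x * y * z) * (m * (w * x * y * z)) =
      (w ^ 2 * x * y * z) * (A * x + B * y + C * z) := by
    calc _ = m * (s * t * u) := by rw [s1, t1, u1]; ring
      _ = A * (t * u) + B * (s * u) + C * (s * t) := eq1
      _ = _ := by rw [s1, t1, u1]; ring
  exact Nat.eq_of_mul_eq_mul_left (by positivity) this

/-- Parameters. -/
structure Par where
  p : ℕ
  q : ℕ
  r : ℕ
  w : ℕ
  x : ℕ
  y : ℕ
  z : ℕ

instance : Nonempty Par := ⟨⟨0, 0, 0, 0, 0, 0, 0⟩⟩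

/-- Admissible parameters. -/
def Adm (m n : ℕ) (v : Par) : Prop :=
  v.p ∣ n ∧ v.q ∣ n ∧ v.r ∣ n ∧ 0 < v.w ∧ 0 < v.x ∧ 0 < v.y ∧ 0 < v.z ∧
  m * (v.w * v.x * v.y * v.z) = n / v.p * v.x + n / v.q * v.y + n / v.r * v.z

/-- Divisor hypothesis. -/
def DivB (Z : ℕ) (Δ : ℝ) : Prop :=
  1 ≤ Δ ∧ ∀ k : ℕ, k ≠ 0 → k ≤ Z → (k.divisors.card : ℝ) ≤ Δ

lemma fiber_pqr {m n Z : ℕ} {Δ K : ℝ} (hn : 0 < n) (hΔ : DivB Z Δ) (hnZ : n ≤ Z) (hK : 0 ≤ K)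
    (S : Set Par) (hS : ∀ v ∈ S, Adm m n v)
    (h : ∀ p q r, p ∣ n → q ∣ n → r ∣ n → Bd {v | v ∈ S ∧ v.p = p ∧ v.q = q ∧ v.r = r} K) :
    Bd S (Δ ^ 3 * K) := by
  have h0 : (0 : ℝ) ≤ Δ := by linarith [hΔ.1]
  have hd := hΔ.2 n hn.ne' hnZ
  have e : Δ ^ 3 * K = Δ * (Δ * (Δ * K)) := by ring
  rw [e]
  refine Bd.fiber_const (fun v => v.p) n.divisors ?_ hd (by positivity) ?_
  · intro v hv; exact Nat.mem_divisors.2 ⟨(hS v hv).1, hn.ne'⟩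
  intro p hp
  refine Bd.fiber_const (fun v => v.q) n.divisors ?_ hd (by positivity) ?_
  · rintro v ⟨hv, -⟩; exact Nat.mem_divisors.2 ⟨(hS v hv).2.1, hn.ne'⟩
  intro q hq
  refine Bd.fiber_const (fun v => v.r) n.divisors ?_ hd (by positivity) ?_
  · rintro v ⟨⟨hv, -⟩, -⟩; exact Nat.mem_divisors.2 ⟨(hS v hv).2.2.1, hn.ne'⟩
  intro r hr
  refine (h p q r (Nat.dvd_of_mem_divisors hp) (Nat.dvd_of_mem_divisors hq)
    (Nat.dvd_of_mem_divisors hr)).mono ?_ le_rfl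
  rintro v ⟨⟨⟨hv, h1⟩, h2⟩, h3⟩
  exact ⟨hv, h1, h2, h3⟩

lemma PA {m n Z Y : ℕ} {Δ : ℝ} (hm : 0 < m) (hn : 0 < n) (hΔ : DivB Z Δ)
    (hZ : m * n * Y ^ 2 + n ^ 2 ≤ Z) :
    Bd {v | Adm m n v ∧ v.w * v.z ≤ Y} (Δ ^ 5 * Y) := by
  have h0 : (0 : ℝ) ≤ Δ := by linarith [hΔ.1]
  have e : Δ ^ 5 * (Y : ℝ) = Δ ^ 3 * (Y * (Δ * (Δ * 1))) := by ring
  rw [e]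
  have hn2 : n ≤ n ^ 2 := Nat.le_self_pow (by norm_num) n
  have hY2 : Y ≤ Y ^ 2 := Nat.le_self_pow (by norm_num) Y
  have hmn : 1 ≤ m * n := Nat.mul_pos hm hn
  have hYZ : Y ^ 2 ≤ m * n * Y ^ 2 := Nat.le_mul_of_pos_left _ hmn
  refine fiber_pqr hn hΔ (by omega) (by positivity) _ (fun v hv => hv.1) ?_
  intro p q r hp hq hr
  obtain ⟨A, hA⟩ : ∃ A, A = n / p := ⟨_, rfl⟩
  obtain ⟨B, hB⟩ : ∃ B, B = n / q := ⟨_, rfl⟩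
  obtain ⟨C, hC⟩ : ∃ C, C = n / r := ⟨_, rfl⟩
  have hAn : A ≤ n := hA ▸ Nat.div_le_self _ _
  have hBn : B ≤ n := hB ▸ Nat.div_le_self _ _
  have hCn : C ≤ n := hC ▸ Nat.div_le_self _ _
  have hC0 : 0 < C := hC ▸ Nat.div_pos (Nat.le_of_dvd hn hr) (Nat.pos_of_dvd_of_pos hr hn)
  refine Bd.fiber_const (fun v => v.w * v.z) (Finset.Icc 1 Y) ?_ (by simp) (by positivity) ?_
  · rintro v ⟨⟨⟨-, -, -, h1, h2, h3, h4, -⟩, hv⟩, -⟩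
    exact Finset.mem_Icc.2 ⟨Nat.mul_pos h1 h4, hv⟩
  intro u hu
  obtain ⟨hu1, huY⟩ := Finset.mem_Icc.1 hu
  refine Bd.fiber_const (fun v => v.z) u.divisors ?_ (hΔ.2 u (by omega) (by omega))
    (by positivity) ?_
  · rintro v ⟨-, hv⟩
    exact Nat.mem_divisors.2 ⟨⟨v.w, by rw [← hv]; ring⟩, by omega⟩
  intro z hz
  have hzu : z ≤ u := Nat.divisor_le hz
  have hz0 : 0 < z := Nat.pos_of_mem_divisors hz
  have hk : m * u * C * z + A * B ≤ Z := by
    refine le_trans ?_ hZ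
    calc m * u * C * z + A * B ≤ m * Y * n * Y + n * n := by gcongr; omega
      _ = _ := by ring
  have hk0 : m * u * C * z + A * B ≠ 0 := by positivity
  have fact : ∀ v : Par, (Adm m n v ∧ v.w * v.z ≤ Y) ∧ v.p = p ∧ v.q = q ∧ v.r = r →
      v.w * v.z = u → v.z = z → ∃ e f, m * u * v.x = B + e ∧ m * u * v.y = A + f ∧
        e * f = m * u * C * z + A * B := by
    rintro ⟨p', q', r', w, x, y, z'⟩ ⟨⟨⟨-, -, -, h1, h2, h3, h4, h5⟩, -⟩, h6, h7, h8⟩ h9 h10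
    dsimp only at *
    subst h6 h7 h8 h10
    rw [← hA, ← hB, ← hC] at h5
    have h5' : m * u * x * y = A * x + B * y + C * z' := by rw [← h5, ← h9]; ring
    have hCz : 0 < C * z' := by positivity
    have b1 : B ≤ m * u * x := by
      by_contra hlt
      push Not at hlt
      have : m * u * x * y ≤ B * y := by gcongr
      have : 0 ≤ A * x := by positivity
      omega
    have b2 : A ≤ m * u * y := by
      by_contra hlt
      push Not at hlt
      have : m * u * y * x ≤ A * x := by gcongr
      have e : m * u * y * x = m * u * x * y := by ring
      have : 0 ≤ B * y := by positivity
      omega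
    obtain ⟨e, he⟩ := Nat.exists_eq_add_of_le b1
    obtain ⟨f, hf⟩ := Nat.exists_eq_add_of_le b2
    refine ⟨e, f, he, hf, ?_⟩
    zify at *
    have he' : (e : ℤ) = m * u * x - B := by linarith
    have hf' : (f : ℤ) = m * u * y - A := by linarith
    rw [he', hf']
    linear_combination (m * u : ℤ) * h5'
  refine Bd.fiber_const (fun v => m * u * v.x - B)
    (m * u * C * z + A * B).divisors ?_ (hΔ.2 _ hk0 hk) (by norm_num) ?_
  · rintro v ⟨⟨hv, h1⟩, h2⟩
    obtain ⟨e, f, he, hf, hef⟩ := fact v hv h1 h2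
    refine Nat.mem_divisors.2 ⟨?_, hk0⟩
    simp only [he, Nat.add_sub_cancel_left]
    exact ⟨f, hef.symm⟩
  intro e he
  have he0 : 0 < e := Nat.pos_of_mem_divisors he
  apply Bd.subsingleton
  rintro v ⟨⟨⟨hv, h1⟩, h2⟩, h3⟩ v' ⟨⟨⟨hv', h1'⟩, h2'⟩, h3'⟩
  obtain ⟨e1, f1, k1, k2, k3⟩ := fact v hv h1 h2
  obtain ⟨e2, f2, k1', k2', k3'⟩ := fact v' hv' h1' h2'
  simp only [k1, k1', Nat.add_sub_cancel_left] at h3 h3'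
  subst h3 h3'
  have hf : f1 = f2 := Nat.eq_of_mul_eq_mul_left he0 (k3.trans k3'.symm)
  subst hf
  have hmu : 0 < m * u := by positivity
  have ex : v.x = v'.x := Nat.eq_of_mul_eq_mul_left hmu (k1.trans k1'.symm)
  have ey : v.y = v'.y := Nat.eq_of_mul_eq_mul_left hmu (k2.trans k2'.symm)
  have ew : v.w = v'.w := Nat.eq_of_mul_eq_mul_right hz0 (by rw [← h2, h1, h2, ← h2', h1'])
  obtain ⟨-, a1, a2, a3⟩ := hv
  obtain ⟨-, b1, b2, b3⟩ := hv'
  cases v; cases v'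
  simp_all

lemma PB {m n Z Y : ℕ} {Δ : ℝ} (hm : 0 < m) (hn : 0 < n) (hΔ : DivB Z Δ)
    (hZ : m * n * Y ^ 2 + n ^ 2 ≤ Z) :
    Bd {v | Adm m n v ∧ v.y * v.z ≤ Y} (Δ ^ 5 * Y) := by
  have h0 : (0 : ℝ) ≤ Δ := by linarith [hΔ.1]
  have e : Δ ^ 5 * (Y : ℝ) = Δ ^ 3 * (Y * (Δ * (Δ * 1))) := by ring
  rw [e]
  have hn2 : n ≤ n ^ 2 := Nat.le_self_pow (by norm_num) n
  have hY2 : Y ≤ Y ^ 2 := Nat.le_self_pow (by norm_num) Y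
  have hmn : 1 ≤ m * n := Nat.mul_pos hm hn
  have hYZ : Y ^ 2 ≤ m * n * Y ^ 2 := Nat.le_mul_of_pos_left _ hmn
  refine fiber_pqr hn hΔ (by omega) (by positivity) _ (fun v hv => hv.1) ?_
  intro p q r hp hq hr
  obtain ⟨A, hA⟩ : ∃ A, A = n / p := ⟨_, rfl⟩
  obtain ⟨B, hB⟩ : ∃ B, B = n / q := ⟨_, rfl⟩
  obtain ⟨C, hC⟩ : ∃ C, C = n / r := ⟨_, rfl⟩
  have hBn : B ≤ n := hB ▸ Nat.div_le_self _ _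
  have hCn : C ≤ n := hC ▸ Nat.div_le_self _ _
  have hC0 : 0 < C := hC ▸ Nat.div_pos (Nat.le_of_dvd hn hr) (Nat.pos_of_dvd_of_pos hr hn)
  refine Bd.fiber_const (fun v => v.y * v.z) (Finset.Icc 1 Y) ?_ (by simp) (by positivity) ?_
  · rintro v ⟨⟨⟨-, -, -, h1, h2, h3, h4, -⟩, hv⟩, -⟩
    exact Finset.mem_Icc.2 ⟨Nat.mul_pos h3 h4, hv⟩
  intro u hu
  obtain ⟨hu1, huY⟩ := Finset.mem_Icc.1 hu
  refine Bd.fiber_const (fun v => v.z) u.divisors ?_ (hΔ.2 u (by omega) (by omega))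
    (by positivity) ?_
  · rintro v ⟨-, hv⟩
    exact Nat.mem_divisors.2 ⟨⟨v.y, by rw [← hv]; ring⟩, by omega⟩
  intro z hz
  have hzu : z ≤ u := Nat.divisor_le hz
  have hz0 : 0 < z := Nat.pos_of_mem_divisors hz
  obtain ⟨y, hy⟩ := Nat.dvd_of_mem_divisors hz
  have hyu : y ≤ u := by rw [hy]; exact Nat.le_mul_of_pos_left _ hz0
  have hk : B * y + C * z ≤ Z := by
    refine le_trans ?_ hZ
    have h1 : B * y + C * z ≤ n * Y + n * Y := by gcongr <;> omega
    have h2 : n * Y + n * Y ≤ Y ^ 2 + n ^ 2 := by nlinarith [sq_nonneg ((n : ℤ) - Y)]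
    omega
  have hk0 : B * y + C * z ≠ 0 := by positivity
  refine Bd.fiber_const (fun v => v.x)
    (B * y + C * z).divisors ?_ (hΔ.2 _ hk0 hk) (by norm_num) ?_
  · rintro ⟨p', q', r', w, x, y', z'⟩
      ⟨⟨⟨⟨⟨-, -, -, h1, h2, h3, h4, h5⟩, -⟩, h6, h7, h8⟩, h9⟩, h10⟩
    dsimp only at *
    subst h6 h7 h8 h10
    rw [← hA, ← hB, ← hC] at h5
    have hyy : y' = y := Nat.eq_of_mul_eq_mul_left hz0 (by rw [← hy, ← h9]; ring)
    subst hyy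
    refine Nat.mem_divisors.2 ⟨?_, hk0⟩
    have : x ∣ A * x + (B * y' + C * z') := ⟨m * (w * y' * z'), by rw [← add_assoc, ← h5]; ring⟩
    exact (Nat.dvd_add_right (dvd_mul_left _ _)).1 this
  intro x hx
  have hx0 : 0 < x := Nat.pos_of_mem_divisors hx
  apply Bd.subsingleton
  rintro ⟨p', q', r', w, x, y', z'⟩
      ⟨⟨⟨⟨⟨⟨-, -, -, h1, h2, h3, h4, h5⟩, -⟩, h6, h7, h8⟩, h9⟩, h10⟩, h11⟩
      ⟨p'', q'', r'', w', x', y'', z''⟩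
      ⟨⟨⟨⟨⟨⟨-, -, -, h1', h2', h3', h4', h5'⟩, -⟩, h6', h7', h8'⟩, h9'⟩, h10'⟩, h11'⟩
  dsimp only at *
  subst h6 h7 h8 h10 h11 h6' h7' h8' h10' h11'
  have hyy : y' = y'' := Nat.eq_of_mul_eq_mul_right hz0 (by rw [h9, h9'])
  subst hyy
  have hw : w = w' := by
    have : (m * (x' * y' * z'')) * w = (m * (x' * y' * z'')) * w' := by
      calc _ = m * (w * x' * y' * z'') := by ring
        _ = m * (w' * x' * y' * z'') := by rw [h5, h5']
        _ = _ := by ring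
    exact Nat.eq_of_mul_eq_mul_left (by positivity) this
  rw [hw]

lemma PA' {m n Z Y : ℕ} {Δ : ℝ} (hm : 0 < m) (hn : 0 < n) (hΔ : DivB Z Δ)
    (hZ : m * n * Y ^ 2 + n ^ 2 ≤ Z) :
    Bd {v | Adm m n v ∧ v.w * v.y ≤ Y} (Δ ^ 5 * Y) := by
  refine Bd.image (fun v => ⟨v.p, v.r, v.q, v.w, v.x, v.z, v.y⟩) (PA hm hn hΔ hZ) ?_
  rintro ⟨p, q, r, w, x, y, z⟩ ⟨⟨h1, h2, h3, h4, h5, h6, h7, h8⟩, h⟩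
  refine ⟨⟨p, r, q, w, x, z, y⟩, ⟨⟨h1, h3, h2, h4, h5, h7, h6, ?_⟩, h⟩, rfl⟩
  dsimp only at *
  linarith

lemma V1 {m n Z Y : ℕ} {Δ : ℝ} (hm : 0 < m) (hn : 0 < n) (hΔ : DivB Z Δ)
    (hZ : m * n * Y ^ 2 + n ^ 2 ≤ Z) :
    Bd {v : ℕ × ℕ × ℕ | Sol3 m n v.1 v.2.1 v.2.2 ∧ Nat.gcd v.1 v.2.1 ≤ Y} (Δ ^ 5 * Y) := by
  refine Bd.image (fun v => (v.p * (v.w * v.y * v.z), v.q * (v.w * v.x * v.z),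
    v.r * (v.w * v.x * v.y))) (PA hm hn hΔ hZ) ?_
  rintro ⟨a, b, c⟩ ⟨h, hY⟩
  dsimp only at *
  obtain ⟨w, x, y, z, hw, hx, hy, hz, ha, hb, hc, he⟩ := sol3_struct h
  refine ⟨⟨Nat.gcd a n, Nat.gcd b n, Nat.gcd c n, w, x, y, z⟩,
    ⟨⟨Nat.gcd_dvd_right _ _, Nat.gcd_dvd_right _ _, Nat.gcd_dvd_right _ _, hw, hx, hy, hz, he⟩,
      ?_⟩, ?_⟩
  · refine le_trans (Nat.le_of_dvd (Nat.gcd_pos_of_pos_left _ h.1) (Nat.dvd_gcd ?_ ?_)) hY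
    · exact ⟨Nat.gcd a n * y, by rw [mul_assoc w, mul_comm y z] at ha; linarith⟩
    · exact ⟨Nat.gcd b n * x, by linarith⟩
  · dsimp only
    rw [← ha, ← hb, ← hc]

lemma V2 {m n Z : ℕ} {Δ R : ℝ} (hm : 0 < m) (hn : 0 < n) (hR : 0 ≤ R) (hΔ : DivB Z Δ)
    (hZ : m * n * ⌊R⌋₊ ^ 2 + n ^ 2 ≤ Z) :
    Bd {v : ℕ × ℕ × ℕ | Sol3 m n v.1 v.2.1 v.2.2 ∧ (v.1 : ℝ) ≤ R * Nat.gcd v.1 n}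
      (3 * Δ ^ 5 * R ^ ((2 : ℝ) / 3)) := by
  have h0 : (0 : ℝ) ≤ Δ := by linarith [hΔ.1]
  set Y := ⌊R ^ ((2 : ℝ) / 3)⌋₊ with hY
  have hYR : Y ≤ ⌊R⌋₊ := by
    rcases lt_or_ge R 1 with h | h
    · have : R ^ ((2 : ℝ) / 3) < 1 := Real.rpow_lt_one hR h (by norm_num)
      have : Y = 0 := Nat.floor_eq_zero.2 this
      omega
    · apply Nat.floor_le_floor
      calc R ^ ((2 : ℝ) / 3) ≤ R ^ (1 : ℝ) := Real.rpow_le_rpow_of_exponent_le h (by norm_num)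
        _ = R := Real.rpow_one R
  have hZ' : m * n * Y ^ 2 + n ^ 2 ≤ Z := le_trans (by gcongr) hZ
  have hYr : (Y : ℝ) ≤ R ^ ((2 : ℝ) / 3) := Nat.floor_le (by positivity)
  have h3 := ((PA hm hn hΔ hZ').union (PA' hm hn hΔ hZ') (U := {v | Adm m n v ∧
      (v.w * v.z ≤ Y ∨ v.w * v.y ≤ Y)}) (by
        rintro v ⟨h1, h2 | h2⟩
        · exact Or.inl ⟨h1, h2⟩
        · exact Or.inr ⟨h1, h2⟩)).union (PB hm hn hΔ hZ') (U := {v | Adm m n v ∧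
      ((v.w * v.z ≤ Y ∨ v.w * v.y ≤ Y) ∨ v.y * v.z ≤ Y)}) (by
        rintro v ⟨h1, h2 | h2⟩
        · exact Or.inl ⟨h1, h2⟩
        · exact Or.inr ⟨h1, h2⟩)
  have h4 : Δ ^ 5 * (Y : ℝ) + Δ ^ 5 * Y + Δ ^ 5 * Y ≤ 3 * Δ ^ 5 * R ^ ((2 : ℝ) / 3) := by
    have : Δ ^ 5 * (Y : ℝ) ≤ Δ ^ 5 * R ^ ((2 : ℝ) / 3) := by gcongr
    linarith
  refine Bd.image (fun v => (v.p * (v.w * v.y * v.z), v.q * (v.w * v.x * v.z),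
    v.r * (v.w * v.x * v.y))) (h3.mono (fun x hx => hx) h4) ?_
  rintro ⟨a, b, c⟩ ⟨h, haR⟩
  dsimp only at *
  obtain ⟨w, x, y, z, hw, hx, hy, hz, ha, hb, hc, he⟩ := sol3_struct h
  refine ⟨⟨Nat.gcd a n, Nat.gcd b n, Nat.gcd c n, w, x, y, z⟩,
    ⟨⟨Nat.gcd_dvd_right _ _, Nat.gcd_dvd_right _ _, Nat.gcd_dvd_right _ _, hw, hx, hy, hz, he⟩,
      ?_⟩, ?_⟩
  · dsimp only
    by_contra hcon
    push Not at hcon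
    obtain ⟨⟨c1, c2⟩, c3⟩ := hcon
    rw [Nat.floor_lt (by positivity)] at c1 c2 c3
    have hg : (0 : ℝ) < Nat.gcd a n := by exact_mod_cast Nat.gcd_pos_of_pos_left _ h.1
    have hwyz : ((w * y * z : ℕ) : ℝ) ≤ R := by
      have : (Nat.gcd a n : ℝ) * ((w * y * z : ℕ) : ℝ) ≤ (Nat.gcd a n : ℝ) * R := by
        rw [← Nat.cast_mul, ← ha]; linarith
      exact le_of_mul_le_mul_left this hg
    have hR3 : R ^ ((2 : ℝ) / 3) * R ^ ((2 : ℝ) / 3) * R ^ ((2 : ℝ) / 3) = R ^ 2 := by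
      rw [← Real.rpow_add_of_nonneg hR (by norm_num) (by norm_num),
        ← Real.rpow_add_of_nonneg hR (by norm_num) (by norm_num), ← Real.rpow_natCast]
      norm_num
    have hpos : 0 ≤ R ^ ((2 : ℝ) / 3) := by positivity
    have l1 : R ^ 2 < ((w * z : ℕ) : ℝ) * ((w * y : ℕ) : ℝ) * ((y * z : ℕ) : ℝ) := by
      rw [← hR3]; gcongr
    have l2 : ((w * z : ℕ) : ℝ) * ((w * y : ℕ) : ℝ) * ((y * z : ℕ) : ℝ)
        = ((w * y * z : ℕ) : ℝ) ^ 2 := by push_cast; ring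
    have l3 : ((w * y * z : ℕ) : ℝ) ^ 2 ≤ R ^ 2 := by gcongr
    linarith
  · dsimp only
    rw [← ha, ← hb, ← hc]


lemma S2 {m n Z : ℕ} {Δ : ℝ} (hm : 0 < m) (hn : 0 < n) (hΔ : DivB Z Δ) (hZ : n ^ 2 ≤ Z) :
    Bd {v : ℕ × ℕ | 0 < v.1 ∧ 0 < v.2 ∧ m * (v.1 * v.2) = n * (v.1 + v.2)} Δ := by
  have fact : ∀ v : ℕ × ℕ, (0 < v.1 ∧ 0 < v.2 ∧ m * (v.1 * v.2) = n * (v.1 + v.2)) →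
      ∃ e f, m * v.1 = n + e ∧ m * v.2 = n + f ∧ e * f = n ^ 2 := by
    rintro ⟨a, b⟩ ⟨ha, hb, h⟩
    dsimp only at *
    have h1 : n ≤ m * a := by
      by_contra hlt
      push Not at hlt
      have : m * a * b ≤ n * b := by gcongr
      have : 0 < n * a := by positivity
      nlinarith
    have h2 : n ≤ m * b := by
      by_contra hlt
      push Not at hlt
      have : m * b * a ≤ n * a := by gcongr
      have : 0 < n * b := by positivity
      nlinarith
    obtain ⟨e, he⟩ := Nat.exists_eq_add_of_le h1
    obtain ⟨f, hf⟩ := Nat.exists_eq_add_of_le h2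
    refine ⟨e, f, he, hf, ?_⟩
    zify at *
    have he' : (e : ℤ) = m * a - n := by linarith
    have hf' : (f : ℤ) = m * b - n := by linarith
    rw [he', hf']
    linear_combination (m : ℤ) * h
  have hk0 : n ^ 2 ≠ 0 := by positivity
  rw [← mul_one Δ]
  refine Bd.fiber_const (fun v => m * v.1 - n) (n ^ 2).divisors ?_ (hΔ.2 _ hk0 hZ) (by norm_num) ?_
  · intro v hv
    obtain ⟨e, f, he, hf, hef⟩ := fact v hv
    refine Nat.mem_divisors.2 ⟨?_, hk0⟩
    simp only [he, Nat.add_sub_cancel_left]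
    exact ⟨f, hef.symm⟩
  intro e he
  have he0 : 0 < e := Nat.pos_of_mem_divisors he
  apply Bd.subsingleton
  rintro v ⟨hv, h3⟩ v' ⟨hv', h3'⟩
  obtain ⟨e1, f1, k1, k2, k3⟩ := fact v hv
  obtain ⟨e2, f2, k1', k2', k3'⟩ := fact v' hv'
  simp only [k1, k1', Nat.add_sub_cancel_left] at h3 h3'
  subst h3 h3'
  have hf : f1 = f2 := Nat.eq_of_mul_eq_mul_left he0 (k3.trans k3'.symm)
  subst hf
  exact Prod.ext (Nat.eq_of_mul_eq_mul_left hm (k1.trans k1'.symm))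
    (Nat.eq_of_mul_eq_mul_left hm (k2.trans k2'.symm))

lemma sum_rpow_aux (J : ℕ) :
    ∑ j ∈ Finset.range J, ((j : ℝ) + 1) ^ (-(2 : ℝ) / 3) ≤ 3 * (J : ℝ) ^ ((1 : ℝ) / 3) := by
  induction J with
  | zero => simp
  | succ J ih =>
    rw [Finset.sum_range_succ]
    have hs : 0 ≤ (J : ℝ) ^ ((1 : ℝ) / 3) := by positivity
    have ht : 0 < ((J : ℝ) + 1) ^ ((1 : ℝ) / 3) := by positivity
    have hs3 : ((J : ℝ) ^ ((1 : ℝ) / 3)) ^ 3 = J := by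
      rw [← Real.rpow_natCast, ← Real.rpow_mul (by positivity)]; norm_num
    have ht3 : (((J : ℝ) + 1) ^ ((1 : ℝ) / 3)) ^ 3 = J + 1 := by
      rw [← Real.rpow_natCast, ← Real.rpow_mul (by positivity)]; norm_num
    have hst : (J : ℝ) ^ ((1 : ℝ) / 3) ≤ ((J : ℝ) + 1) ^ ((1 : ℝ) / 3) := by gcongr; linarith
    have e : ((J : ℝ) + 1) ^ (-(2 : ℝ) / 3) = 1 / (((J : ℝ) + 1) ^ ((1 : ℝ) / 3)) ^ 2 := by
      rw [← Real.rpow_natCast, ← Real.rpow_mul (by positivity), one_div,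
        ← Real.rpow_neg (by positivity)]
      norm_num
    push_cast
    rw [e]
    set s := (J : ℝ) ^ ((1 : ℝ) / 3)
    set t := ((J : ℝ) + 1) ^ ((1 : ℝ) / 3)
    have h1 : 1 / t ^ 2 ≤ 3 * (t - s) := by
      rw [div_le_iff₀ (by positivity)]
      have : (1 : ℝ) = (t - s) * (t ^ 2 + t * s + s ^ 2) := by ring_nf; linarith
      rw [this]
      have h2 : t ^ 2 + t * s + s ^ 2 ≤ 3 * t ^ 2 := by nlinarith
      nlinarith
    linarith

lemma apsum (m n : ℕ) (hm : 0 < m) (D : ℝ) (hD : 0 ≤ D) (I : Finset ℕ)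
    (hI : ∀ a ∈ I, n < m * a ∧ (m : ℝ) * a - n ≤ D) :
    ∑ a ∈ I, ((m : ℝ) * a - n) ^ (-(2 : ℝ) / 3) ≤ 1 + 3 * D ^ ((1 : ℝ) / 3) / m := by
  classical
  have hm' : (0 : ℝ) < m := by exact_mod_cast hm
  set a0 := n / m + 1 with ha0
  set J := ⌊D / m⌋₊ with hJ
  have hge : ∀ a ∈ I, a0 ≤ a := by
    intro a ha
    have h1 := (hI a ha).1
    have : n / m < a := (Nat.div_lt_iff_lt_mul hm).2 (by rw [mul_comm]; exact h1)
    omega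
  have hna0 : n < m * a0 := by
    rw [ha0]; exact Nat.lt_mul_div_succ n hm
  have hna0' : (n : ℝ) < m * a0 := by exact_mod_cast hna0
  let h : ℕ → ℝ := fun j => if j = 0 then 1 else ((m : ℝ) * j) ^ (-(2 : ℝ) / 3)
  have hh : ∀ j, 0 ≤ h j := by
    intro j; simp only [h]; split_ifs <;> positivity
  have s1 : ∑ a ∈ I, ((m : ℝ) * a - n) ^ (-(2 : ℝ) / 3) ≤ ∑ a ∈ I, h (a - a0) := by
    apply Finset.sum_le_sum
    intro a ha
    obtain ⟨j, rfl⟩ := Nat.exists_eq_add_of_le (hge a ha)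
    have h1 := (hI _ ha).1
    have h1' : (n : ℝ) + 1 ≤ m * ((a0 + j : ℕ) : ℝ) := by exact_mod_cast h1
    simp only [Nat.add_sub_cancel_left, h]
    split_ifs with hj
    · apply Real.rpow_le_one_of_one_le_of_nonpos
      · linarith
      · norm_num
    · apply Real.rpow_le_rpow_of_nonpos
      · positivity
      · push_cast; nlinarith
      · norm_num
  have s2 : ∑ a ∈ I, h (a - a0) ≤ ∑ j ∈ Finset.range (J + 1), h j := by
    rw [← Finset.sum_image (f := h) (g := fun a => a - a0) (s := I)]
    · apply Finset.sum_le_sum_of_subset_of_nonneg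
      · intro j hj
        obtain ⟨a, ha, rfl⟩ := Finset.mem_image.1 hj
        obtain ⟨j, rfl⟩ := Nat.exists_eq_add_of_le (hge a ha)
        rw [Nat.add_sub_cancel_left, Finset.mem_range, Nat.lt_succ_iff]
        apply Nat.le_floor
        rw [le_div_iff₀ hm']
        have := (hI _ ha).2
        push_cast at this
        nlinarith
      · intros; exact hh _
    · intro a ha b hb hab
      have := hge a ha
      have := hge b hb
      simp only at hab
      omega
  have s3 : ∑ j ∈ Finset.range (J + 1), h j =
      1 + (m : ℝ) ^ (-(2 : ℝ) / 3) * ∑ j ∈ Finset.range J, ((j : ℝ) + 1) ^ (-(2 : ℝ) / 3) := by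
    rw [Finset.sum_range_succ', add_comm, Finset.mul_sum]
    simp only [h, if_true]
    congr 1
    apply Finset.sum_congr rfl
    intro j _
    rw [if_neg (by omega), Real.mul_rpow hm'.le (by positivity)]
    push_cast; rfl
  have s4 := sum_rpow_aux J
  have s5 : (J : ℝ) ^ ((1 : ℝ) / 3) ≤ (D / m) ^ ((1 : ℝ) / 3) := by
    gcongr
    exact Nat.floor_le (by positivity)
  have s6 : (m : ℝ) ^ (-(2 : ℝ) / 3) * (3 * (D / m) ^ ((1 : ℝ) / 3)) =
      3 * D ^ ((1 : ℝ) / 3) / m := by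
    rw [Real.div_rpow hD hm'.le]
    have : (m : ℝ) ^ (-(2 : ℝ) / 3) = (m : ℝ) ^ ((1 : ℝ) / 3) / m := by
      rw [← Real.rpow_sub_one hm'.ne']; norm_num
    rw [this]
    have : (m : ℝ) ^ ((1 : ℝ) / 3) ≠ 0 := by positivity
    field_simp
  calc _ ≤ _ := s1
    _ ≤ _ := s2
    _ = _ := s3
    _ ≤ 1 + (m : ℝ) ^ (-(2 : ℝ) / 3) * (3 * (D / m) ^ ((1 : ℝ) / 3)) := by
      gcongr
      linarith
    _ = _ := by rw [s6]

/-- Ordered solutions with four terms. -/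
def S4 (m n : ℕ) : Set (ℕ × ℕ × ℕ × ℕ) :=
  {v | 0 < v.1 ∧ v.1 ≤ v.2.1 ∧ v.2.1 ≤ v.2.2.1 ∧ v.2.2.1 ≤ v.2.2.2 ∧
    m * (v.1 * v.2.1 * v.2.2.1 * v.2.2.2) =
      n * (v.2.1 * v.2.2.1 * v.2.2.2 + v.1 * v.2.2.1 * v.2.2.2 + v.1 * v.2.1 * v.2.2.2
        + v.1 * v.2.1 * v.2.2.1)}

lemma S4_facts {m n a b c d : ℕ} (hn : 0 < n) (h : (a, b, c, d) ∈ S4 m n) :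
    0 < a ∧ a ≤ b ∧ b ≤ c ∧ c ≤ d ∧ ∃ M K : ℕ, 0 < M ∧ 0 < K ∧ m * a = n + M ∧ m * a ≤ 4 * n ∧
      Sol3 M (n * a) b c d ∧ M * b = n * a + K ∧ M * b ≤ 3 * (n * a) ∧
      K * (c * d) = n * a * b * (c + d) ∧ K * c ≤ 2 * (n * a * b) := by
  obtain ⟨ha, hab, hbc, hcd, h⟩ := h
  dsimp only at *
  have hb : 0 < b := by omega
  have hc : 0 < c := by omega
  have hd : 0 < d := by omega
  have h1 : n < m * a := by
    have : n * (b * c * d) < (m * a) * (b * c * d) := by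
      have : 0 < n * (a * c * d) := by positivity
      have : 0 ≤ n * (a * b * d + a * b * c) := by positivity
      nlinarith
    exact lt_of_mul_lt_mul_right this (by positivity)
  obtain ⟨M, hM⟩ := Nat.exists_eq_add_of_lt h1
  have hM' : m * a = n + (M + 1) := by omega
  obtain ⟨M', hMM⟩ : ∃ M', M' = M + 1 := ⟨_, rfl⟩
  rw [← hMM] at hM'
  have e3 : M' * (b * c * d) = n * a * (c * d + b * d + b * c) := by
    have : (m * a) * (b * c * d) = n * (b * c * d) + n * a * (c * d + b * d + b * c) := by
      linarith
    rw [hM'] at this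
    linarith
  have h2 : n * a < M' * b := by
    have : n * a * (c * d) < (M' * b) * (c * d) := by
      have : 0 < n * a * (b * d) := by positivity
      have : 0 ≤ n * a * (b * c) := by positivity
      nlinarith
    exact lt_of_mul_lt_mul_right this (by positivity)
  obtain ⟨K, hK⟩ := Nat.exists_eq_add_of_lt h2
  have hK' : M' * b = n * a + (K + 1) := by omega
  obtain ⟨K', hKK⟩ : ∃ K', K' = K + 1 := ⟨_, rfl⟩
  rw [← hKK] at hK'
  have e2 : K' * (c * d) = n * a * b * (c + d) := by
    have : (M' * b) * (c * d) = n * a * (c * d) + n * a * b * (c + d) := by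
      linarith
    rw [hK'] at this
    linarith
  refine ⟨ha, hab, hbc, hcd, M', K', by omega, by omega, hM', ?_, ⟨hb, hc, hd, e3⟩, hK', ?_,
    e2, ?_⟩
  · have : (m * a) * (b * c * d) ≤ (4 * n) * (b * c * d) := by
      have i1 : a * c * d ≤ b * c * d := by gcongr
      have i2 : a * b * d ≤ c * b * d := by gcongr; omega
      have i3 : a * b * c ≤ d * b * c := by gcongr; omega
      calc (m * a) * (b * c * d) = n * (b * c * d + a * c * d + a * b * d + a * b * c) := by
            linarith
        _ ≤ n * (b * c * d + b * c * d + c * b * d + d * b * c) := by gcongr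
        _ = _ := by ring
    exact le_of_mul_le_mul_right this (by positivity)
  · have : (M' * b) * (c * d) ≤ (3 * (n * a)) * (c * d) := by
      calc (M' * b) * (c * d) = n * a * (c * d + b * d + b * c) := by linarith
        _ ≤ n * a * (c * d + c * d + d * c) := by gcongr; omega
        _ = _ := by ring
    exact le_of_mul_le_mul_right this (by positivity)
  · have : (K' * c) * d ≤ (2 * (n * a * b)) * d := by
      calc (K' * c) * d = n * a * b * (c + d) := by linarith
        _ ≤ n * a * b * (d + d) := by gcongr
        _ = _ := by ring
    exact le_of_mul_le_mul_right this (by positivity)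

lemma TL {m n Z : ℕ} {Δ D G : ℝ} (hm : 0 < m) (hn : 0 < n) (hD : 0 ≤ D) (hG : 1 ≤ G)
    (hΔ : DivB Z Δ) (hZ : 50000 * n ^ 12 ≤ Z) :
    Bd {v | v ∈ S4 m n ∧ (m : ℝ) * v.1 - n ≤ D ∧ G ≤ Nat.gcd v.1 v.2.1}
      (3 * Δ ^ 5 * (12 * (n : ℝ) ^ 2 / (m * G)) ^ ((2 : ℝ) / 3) *
        (1 + 3 * D ^ ((1 : ℝ) / 3) / m)) := by
  classical
  have h0 : (0 : ℝ) ≤ Δ := by linarith [hΔ.1]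
  have hmr : (1 : ℝ) ≤ m := by exact_mod_cast hm
  have hnr : (1 : ℝ) ≤ n := by exact_mod_cast hn
  set I := (Finset.range (4 * n + 1)).filter
    (fun a => n < m * a ∧ m * a ≤ 4 * n ∧ (m : ℝ) * a - n ≤ D) with hI
  have hap := apsum m n hm D hD I (by
    intro a ha
    have := (Finset.mem_filter.1 ha).2
    exact ⟨this.1, this.2.2⟩)
  set R0 := 12 * (n : ℝ) ^ 2 / (m * G) with hR0
  have hR0p : 0 ≤ R0 := by positivity
  have hR0n : R0 ≤ 12 * (n : ℝ) ^ 2 := by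
    apply div_le_self (by positivity)
    nlinarith
  refine (Bd.fiber (fun v => v.1) I
    (fun a => 3 * Δ ^ 5 * R0 ^ ((2 : ℝ) / 3) * ((m : ℝ) * a - n) ^ (-(2 : ℝ) / 3)) ?_ ?_).mono
    (fun x hx => hx) ?_
  · rintro ⟨a, b, c, d⟩ ⟨hv, hvD, -⟩
    obtain ⟨ha, -, -, -, M, K, hM, hK, e1, i1, -⟩ := S4_facts hn hv
    have : a ≤ m * a := Nat.le_mul_of_pos_left _ hm
    refine Finset.mem_filter.2 ⟨Finset.mem_range.2 (by dsimp only; omega), by dsimp only; omega, i1, hvD⟩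
  · intro a ha
    obtain ⟨-, ha1, ha2, ha3⟩ := Finset.mem_filter.1 ha
    obtain ⟨M, hM⟩ := Nat.exists_eq_add_of_le ha1.le
    have hM0 : 0 < M := by omega
    have hMr : (m : ℝ) * a - n = M := by
      have : (m : ℝ) * a = n + M := by exact_mod_cast hM
      linarith
    have ha0 : 0 < a := Nat.pos_of_ne_zero (by rintro rfl; simp at ha1)
    have haa : a ≤ m * a := Nat.le_mul_of_pos_left _ hm
    have hM1 : (1 : ℝ) ≤ M := by exact_mod_cast hM0
    rw [hMr]
    set R := R0 / M with hR
    have hRp : 0 ≤ R := by positivity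
    have hRn : R ≤ 12 * (n : ℝ) ^ 2 := (div_le_self hR0p hM1).trans hR0n
    have hRf : ⌊R⌋₊ ≤ 12 * n ^ 2 := by
      apply Nat.floor_le_of_le
      push_cast; exact hRn
    have hZ' : M * (n * a) * ⌊R⌋₊ ^ 2 + (n * a) ^ 2 ≤ Z := by
      refine le_trans ?_ hZ
      calc M * (n * a) * ⌊R⌋₊ ^ 2 + (n * a) ^ 2
          ≤ (3 * n) * (n * (4 * n)) * (12 * n ^ 2) ^ 2 + (n * (4 * n)) ^ 2 := by
            gcongr <;> omega
        _ = 1728 * n ^ 7 + 16 * n ^ 4 := by ring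
        _ ≤ 1728 * n ^ 12 + 16 * n ^ 12 := by gcongr <;> omega
        _ ≤ _ := by linarith [Nat.zero_le (n ^ 12)]
    have hv2 := V2 (R := R) hM0 (Nat.mul_pos hn ha0) hRp hΔ hZ'
    have e : 3 * Δ ^ 5 * R ^ ((2 : ℝ) / 3) =
        3 * Δ ^ 5 * R0 ^ ((2 : ℝ) / 3) * (M : ℝ) ^ (-(2 : ℝ) / 3) := by
      rw [hR, Real.div_rpow hR0p (by positivity), neg_div, Real.rpow_neg (by positivity)]
      ring
    rw [e] at hv2
    refine Bd.inj (fun v => v.2) hv2 ?_ ?_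
    · rintro ⟨a', b, c, d⟩ ⟨⟨hv, hvD, hvG⟩, rfl⟩
      dsimp only at *
      obtain ⟨-, hab, hbc, hcd, M', K, hM', hK, e1, i1, hs, e2, i2, -⟩ := S4_facts hn hv
      have hMM : M' = M := by omega
      subst hMM
      refine ⟨hs, ?_⟩
      have g1 : Nat.gcd a' b ≤ Nat.gcd b (n * a') := by
        apply Nat.le_of_dvd (Nat.gcd_pos_of_pos_left _ (by omega))
        exact Nat.dvd_gcd (Nat.gcd_dvd_right _ _) ((Nat.gcd_dvd_left _ _).trans (dvd_mul_left _ _))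
      have g2 : G ≤ (Nat.gcd b (n * a') : ℝ) := hvG.trans (by exact_mod_cast g1)
      have i2' : (M' : ℝ) * b ≤ 3 * (n * a') := by exact_mod_cast i2
      have i1' : (m : ℝ) * a' ≤ 4 * n := by exact_mod_cast i1
      calc (b : ℝ) ≤ R * G := by
            rw [hR, hR0]
            have hG0 : 0 < G := by linarith
            have : 12 * (n : ℝ) ^ 2 / (m * G) / M' * G = 12 * (n : ℝ) ^ 2 / (m * M') := by
              field_simp
            rw [this, le_div_iff₀ (by positivity)]
            calc (b : ℝ) * (m * M') = m * (M' * b) := by ring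
              _ ≤ m * (3 * (n * a')) := by gcongr
              _ = 3 * n * (m * a') := by ring
              _ ≤ 3 * n * (4 * n) := by gcongr
              _ = _ := by ring
        _ ≤ _ := by gcongr
    · rintro ⟨a', v⟩ ⟨_, rfl⟩ ⟨a'', v'⟩ ⟨_, h⟩ hvv
      dsimp only at *
      rw [h, hvv]
  · rw [← Finset.mul_sum]
    gcongr


lemma T2L {m n Z : ℕ} {Δ E : ℝ} (hm : 0 < m) (hn : 0 < n) (hE : 0 ≤ E)
    (hmE : (m : ℝ) * E ≤ (n : ℝ) ^ 2)
    (hΔ : DivB Z Δ) (hZ : 50000 * n ^ 12 ≤ Z) :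
    Bd {v | v ∈ S4 m n ∧ ((m : ℝ) * v.1 - n) * v.2.1 - n * v.1 ≤ E} (E * Δ ^ 2) := by
  have h0 : (0 : ℝ) ≤ Δ := by linarith [hΔ.1]
  have hn2 : n ^ 2 ≤ n ^ 12 := Nat.pow_le_pow_right hn (by norm_num)
  have hn8 : n ^ 8 ≤ n ^ 12 := Nat.pow_le_pow_right hn (by norm_num)
  have e : E * Δ ^ 2 = E * (Δ * Δ) := by ring
  rw [e]
  refine Bd.fiber_const (fun v => (m * v.1 - n) * v.2.1 - n * v.1) (Finset.Icc 1 ⌊E⌋₊) ?_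
    (by simpa using Nat.floor_le hE) (by positivity) ?_
  · rintro ⟨a, b, c, d⟩ ⟨hv, hvE⟩
    obtain ⟨ha, hab, hbc, hcd, M, K, hM, hK, e1, i1, hs, e2, i2, e3, i3⟩ := S4_facts hn hv
    dsimp only at *
    have t1 : m * a - n = M := by omega
    have t2 : M * b - n * a = K := by omega
    rw [t1, t2]
    refine Finset.mem_Icc.2 ⟨hK, Nat.le_floor ?_⟩
    have e1' : (m : ℝ) * a = n + M := by exact_mod_cast e1
    have e2' : (M : ℝ) * b = n * a + K := by exact_mod_cast e2
    rw [e1'] at hvE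
    linarith
  intro K hKI
  obtain ⟨hK1, hK2⟩ := Finset.mem_Icc.1 hKI
  have hKE : (K : ℝ) ≤ E := (Nat.le_floor_iff hE).1 hK2
  have hmK : m * K ≤ n ^ 2 := by
    have : (m : ℝ) * K ≤ (n : ℝ) ^ 2 := le_trans (by gcongr) hmE
    exact_mod_cast this
  have hk0 : m * K + n ^ 2 ≠ 0 := by positivity
  have fact : ∀ a b c d, (a, b, c, d) ∈ S4 m n → (m * a - n) * b - n * a = K →
      ∃ M f, 0 < M ∧ m * a = n + M ∧ m * b = n + f ∧ M * f = m * K + n ^ 2 ∧ M * b = n * a + K ∧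
      a ≤ 4 * n ∧ b ≤ 12 * n ^ 2 ∧ K * (c * d) = n * a * b * (c + d) := by
    intro a b c d hv hK
    obtain ⟨ha, hab, hbc, hcd, M, K', hM, hK', e1, i1, hs, e2, i2, e3, i3⟩ := S4_facts hn hv
    have t1 : m * a - n = M := by omega
    rw [t1] at hK
    have t2 : K' = K := by omega
    subst t2
    have hmb : n ≤ m * b := by
      have : m * a ≤ m * b := by gcongr
      omega
    obtain ⟨f, hf⟩ := Nat.exists_eq_add_of_le hmb
    have hab4 : a ≤ 4 * n := le_trans (Nat.le_mul_of_pos_left _ hm) i1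
    refine ⟨M, f, hM, e1, hf, ?_, e2, hab4, ?_, e3⟩
    · zify at *
      have hf' : (f : ℤ) = m * b - n := by linarith
      rw [hf']
      linear_combination (m : ℤ) * e2 + (n : ℤ) * e1
    · calc b ≤ M * b := Nat.le_mul_of_pos_left _ hM
        _ ≤ 3 * (n * a) := i2
        _ ≤ 3 * (n * (4 * n)) := by gcongr
        _ = _ := by ring
  refine Bd.fiber_const (fun v => m * v.1 - n) (m * K + n ^ 2).divisors ?_
    (hΔ.2 _ hk0 (by omega)) (by positivity) ?_
  · rintro ⟨a, b, c, d⟩ ⟨⟨hv, -⟩, hK⟩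
    obtain ⟨M, f, hM, e1, e2, e3, -⟩ := fact a b c d hv hK
    refine Nat.mem_divisors.2 ⟨?_, hk0⟩
    simp only [e1, Nat.add_sub_cancel_left]
    exact ⟨f, e3.symm⟩
  intro M hMd
  by_cases hne : ∃ a b c d, ((a, b, c, d) ∈ S4 m n ∧ (m * a - n) * b - n * a = K) ∧ m * a - n = M
  · obtain ⟨a, b, c, d, ⟨hv, hK⟩, hM⟩ := hne
    obtain ⟨M', f, hM', e1, e2, e3, e4, i1, i2, -⟩ := fact a b c d hv hK
    have : M' = M := by omega
    subst this
    have hb : 0 < b := by have := hv.1; have := hv.2.1; dsimp only at *; omega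
    have ha : 0 < a := hv.1
    have hZ2 : (n * a * b) ^ 2 ≤ Z := by
      refine le_trans ?_ hZ
      calc (n * a * b) ^ 2 ≤ (n * (4 * n) * (12 * n ^ 2)) ^ 2 := by gcongr
        _ = 2304 * n ^ 8 := by ring
        _ ≤ 50000 * n ^ 12 := by omega
    refine Bd.inj (fun v => v.2.2) (S2 (m := K) (n := n * a * b) hK1 (by positivity) hΔ hZ2) ?_ ?_
    all_goals
      have hab : ∀ v : ℕ × ℕ × ℕ × ℕ, ((v ∈ S4 m n ∧ ((m : ℝ) * v.1 - n) * v.2.1 - n * v.1 ≤ E) ∧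
          (m * v.1 - n) * v.2.1 - n * v.1 = K) ∧ m * v.1 - n = M' → v.1 = a ∧ v.2.1 = b ∧
          K * (v.2.2.1 * v.2.2.2) = n * a * b * (v.2.2.1 + v.2.2.2) := by
        rintro ⟨a', b', c', d'⟩ ⟨⟨⟨hv', -⟩, hK'⟩, hMM⟩
        obtain ⟨M'', f', hM'', e1', e2', e3', e4', i1', i2', e5⟩ := fact a' b' c' d' hv' hK'
        dsimp only at *
        have : M'' = M' := by omega
        subst this
        have haa : a' = a := Nat.eq_of_mul_eq_mul_left hm (e1'.trans e1.symm)
        subst haa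
        have hbb : b' = b := Nat.eq_of_mul_eq_mul_left hM' (e4'.trans e4.symm)
        subst hbb
        exact ⟨rfl, rfl, e5⟩
    · rintro ⟨a', b', c', d'⟩ hv'
      have h1 := (hab _ hv').2.2
      obtain ⟨q1, q2, q3, q4, -⟩ := hv'.1.1.1
      dsimp only at *
      refine ⟨?_, ?_, h1⟩ <;> dsimp only <;> omega
    · rintro ⟨a', b', w⟩ hv' ⟨a'', b'', w'⟩ hv'' hww
      have h1 := hab _ hv'
      have h2 := hab _ hv''
      dsimp only at *
      rw [h1.1, h1.2.1, h2.1, h2.2.1, hww]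
  · intro F hF
    have : F = ∅ := by
      apply Finset.eq_empty_of_forall_notMem
      rintro ⟨a, b, c, d⟩ hx
      obtain ⟨⟨⟨q1, -⟩, q2⟩, q3⟩ := hF _ hx
      exact hne ⟨a, b, c, d, ⟨q1, q2⟩, q3⟩
    rw [this]; simpa using h0

lemma T3L {m n Z : ℕ} {Δ D E G : ℝ} (hm : 0 < m) (hn : 0 < n) (hmn : m ≤ 4 * n) (hE : 0 < E)
    (hD : 0 < D) (hG : 0 ≤ G) (hGn : G ≤ n)
    (hΔ : DivB Z Δ) (hZ : 50000 * n ^ 12 ≤ Z) :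
    Bd {v | v ∈ S4 m n ∧ D ≤ (m : ℝ) * v.1 - n ∧ E ≤ ((m : ℝ) * v.1 - n) * v.2.1 - n * v.1 ∧
      (Nat.gcd v.1 v.2.1 : ℝ) ≤ G} (96 * (n : ℝ) ^ 4 / (m ^ 2 * D * E) * (Δ ^ 5 * G)) := by
  classical
  have h0 : (0 : ℝ) ≤ Δ := by linarith [hΔ.1]
  have hmr : (1 : ℝ) ≤ m := by exact_mod_cast hm
  have hn10 : n ^ 10 ≤ n ^ 12 := Nat.pow_le_pow_right hn (by norm_num)
  set C := 96 * (n : ℝ) ^ 4 / (m ^ 2 * D * E) with hC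
  have hC0 : 0 ≤ C := by positivity
  set I := (Finset.Icc 1 (96 * n ^ 4)).filter (fun c => n < m * c ∧ (c : ℝ) ≤ C) with hI
  refine Bd.fiber_const (fun v => v.2.2.1) I ?_ ?_ (by positivity) ?_
  · rintro ⟨a, b, c, d⟩ ⟨hv, hvD, hvE, -⟩
    obtain ⟨ha, hab, hbc, hcd, M, K, hM, hK, e1, i1, hs, e2, i2, e3, i3⟩ := S4_facts hn hv
    dsimp only at *
    have e1' : (m : ℝ) * a = n + M := by exact_mod_cast e1
    have e2' : (M : ℝ) * b = n * a + K := by exact_mod_cast e2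
    have i1' : (m : ℝ) * a ≤ 4 * n := by exact_mod_cast i1
    have i2' : (M : ℝ) * b ≤ 3 * (n * a) := by exact_mod_cast i2
    have i3' : (K : ℝ) * c ≤ 2 * (n * a * b) := by exact_mod_cast i3
    have hMD : D ≤ M := by linarith
    have hKE : E ≤ K := by
      rw [e1'] at hvE; linarith
    have hab4 : a ≤ 4 * n := le_trans (Nat.le_mul_of_pos_left _ hm) i1
    have hb12 : b ≤ 12 * n ^ 2 := by
      calc b ≤ M * b := Nat.le_mul_of_pos_left _ hM
        _ ≤ 3 * (n * a) := i2
        _ ≤ 3 * (n * (4 * n)) := by gcongr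
        _ = _ := by ring
    have hmac : m * a ≤ m * c := by gcongr; omega
    refine Finset.mem_filter.2 ⟨Finset.mem_Icc.2 ⟨by omega, ?_⟩, by omega, ?_⟩
    · calc c ≤ K * c := Nat.le_mul_of_pos_left _ hK
        _ ≤ 2 * (n * a * b) := i3
        _ ≤ 2 * (n * (4 * n) * (12 * n ^ 2)) := by gcongr
        _ = _ := by ring
    · rw [hC, le_div_iff₀ (by positivity)]
      calc (c : ℝ) * ((m : ℝ) ^ 2 * D * E) ≤ (c : ℝ) * ((m : ℝ) ^ 2 * M * K) := by gcongr
        _ = (m : ℝ) ^ 2 * M * (K * c) := by ring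
        _ ≤ (m : ℝ) ^ 2 * M * (2 * (n * a * b)) := by gcongr
        _ = 2 * (m : ℝ) ^ 2 * n * a * (M * b) := by ring
        _ ≤ 2 * (m : ℝ) ^ 2 * n * a * (3 * (n * a)) := by gcongr
        _ = 6 * (n : ℝ) ^ 2 * (m * a) ^ 2 := by ring
        _ ≤ 6 * (n : ℝ) ^ 2 * (4 * n) ^ 2 := by gcongr
        _ = _ := by ring
  · calc (I.card : ℝ) ≤ ((Finset.Icc 1 ⌊C⌋₊).card : ℝ) := by
          gcongr
          intro c hc
          obtain ⟨h1, h2⟩ := Finset.mem_filter.1 hc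
          exact Finset.mem_Icc.2 ⟨(Finset.mem_Icc.1 h1).1, Nat.le_floor h2.2⟩
      _ = (⌊C⌋₊ : ℝ) := by simp
      _ ≤ C := Nat.floor_le hC0
  intro c hc
  obtain ⟨h1, h2, -⟩ := Finset.mem_filter.1 hc
  obtain ⟨hc1, hc2⟩ := Finset.mem_Icc.1 h1
  obtain ⟨M, hM⟩ := Nat.exists_eq_add_of_le h2.le
  have hM0 : 0 < M := by omega
  have hGf : ⌊G⌋₊ ≤ n := Nat.floor_le_of_le hGn
  have hMc : M ≤ (4 * n) * (96 * n ^ 4) := by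
    calc M ≤ m * c := by omega
      _ ≤ _ := by gcongr
  have hZ' : M * (n * c) * ⌊G⌋₊ ^ 2 + (n * c) ^ 2 ≤ Z := by
    refine le_trans ?_ hZ
    calc M * (n * c) * ⌊G⌋₊ ^ 2 + (n * c) ^ 2
        ≤ ((4 * n) * (96 * n ^ 4)) * (n * (96 * n ^ 4)) * n ^ 2 + (n * (96 * n ^ 4)) ^ 2 := by
          gcongr
      _ = 36864 * n ^ 12 + 9216 * n ^ 10 := by ring
      _ ≤ _ := by omega
  have hb := V1 (Y := ⌊G⌋₊) hM0 (Nat.mul_pos hn hc1) hΔ hZ'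
  refine (Bd.inj (S := {x | x ∈ {v | v ∈ S4 m n ∧ D ≤ (m : ℝ) * v.1 - n ∧
      E ≤ ((m : ℝ) * v.1 - n) * v.2.1 - n * v.1 ∧
      (Nat.gcd v.1 v.2.1 : ℝ) ≤ G} ∧ x.2.2.1 = c}) (fun v => (v.1, v.2.1, v.2.2.2)) hb ?_ ?_).mono
    (fun x hx => hx) ?_
  · rintro ⟨a, b, c', d⟩ ⟨⟨hv, -, -, hg⟩, rfl⟩
    obtain ⟨q1, q2, q3, q4, q5⟩ := hv
    dsimp only at *
    refine ⟨⟨q1, ?_, ?_, ?_⟩, Nat.le_floor hg⟩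
    · dsimp only; omega
    · dsimp only; omega
    · dsimp only
      have : (m * c') * (a * b * d) = n * (a * b * d) + n * c' * (b * d + a * d + a * b) := by
        linarith
      rw [hM] at this
      linarith
  · rintro ⟨a, b, c', d⟩ ⟨_, h⟩ ⟨a', b', c'', d'⟩ ⟨_, h'⟩ hh
    simp only [Prod.mk.injEq] at *
    omega
  · gcongr
    exact Nat.floor_le hG

lemma F4 {m n Z : ℕ} {Δ : ℝ} (hm : 0 < m) (hn : 0 < n)
    (hΔ : DivB Z Δ) (hZ : 50000 * n ^ 12 ≤ Z) :
    Bd (S4 m n) (600 * Δ ^ 5 * ((n : ℝ) ^ ((28 : ℝ) / 17) / m +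
      (n : ℝ) ^ ((4 : ℝ) / 3) * (m : ℝ) ^ (-(2 : ℝ) / 3))) := by
  have h0 : (1 : ℝ) ≤ Δ := hΔ.1
  have hmr : (1 : ℝ) ≤ m := by exact_mod_cast hm
  have hnr : (1 : ℝ) ≤ n := by exact_mod_cast hn
  have hn0 : (0 : ℝ) < n := by linarith
  have hm0 : (0 : ℝ) < m := by linarith
  set x : ℝ := (n : ℝ) with hx
  by_cases hmn : m ≤ 4 * n
  swap
  · intro F hF
    have : F = ∅ := by
      apply Finset.eq_empty_of_forall_notMem
      rintro ⟨a, b, c, d⟩ hx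
      obtain ⟨ha, -, -, -, M, K, hM, hK, e1, i1, -⟩ := S4_facts hn (hF _ hx)
      have : m ≤ m * a := Nat.le_mul_of_pos_right _ ha
      omega
    rw [this]
    simp only [Finset.card_empty, Nat.cast_zero]
    positivity
  have t1 := TL (D := x ^ ((13 : ℝ) / 17)) (G := 1) hm hn (by positivity) le_rfl hΔ hZ
  have t4 := TL (D := 3 * x) (G := x ^ ((1 : ℝ) / 17)) hm hn (by positivity)
    (Real.one_le_rpow hnr (by norm_num)) hΔ hZ
  have t2 := T2L (E := x ^ ((28 : ℝ) / 17) / m) hm hn (by positivity) (by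
    have : (m : ℝ) * (x ^ ((28 : ℝ) / 17) / m) = x ^ ((28 : ℝ) / 17) := by field_simp
    rw [this, ← Real.rpow_natCast]
    exact Real.rpow_le_rpow_of_exponent_le hnr (by norm_num)) hΔ hZ
  have t3 := T3L (D := x ^ ((13 : ℝ) / 17)) (E := x ^ ((28 : ℝ) / 17) / m)
    (G := x ^ ((1 : ℝ) / 17)) hm hn hmn (by positivity) (by positivity) (by positivity) (by
      calc x ^ ((1 : ℝ) / 17) ≤ x ^ (1 : ℝ) :=
            Real.rpow_le_rpow_of_exponent_le hnr (by norm_num)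
        _ = x := Real.rpow_one x) hΔ hZ
  -- combine
  have u12 := t1.union t2 (U := {v | v ∈ S4 m n ∧ ((m : ℝ) * v.1 - x ≤ x ^ ((13 : ℝ) / 17) ∨
    ((m : ℝ) * v.1 - x) * v.2.1 - x * v.1 ≤ x ^ ((28 : ℝ) / 17) / m)}) (by
      rintro ⟨a, b, c, d⟩ ⟨hv, h | h⟩
      · left
        refine ⟨hv, h, ?_⟩
        have : 1 ≤ Nat.gcd a b := Nat.gcd_pos_of_pos_left _ hv.1
        exact_mod_cast this
      · exact Or.inr ⟨hv, h⟩)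
  have u34 := t3.union t4 (U := {v | v ∈ S4 m n ∧ ¬ ((m : ℝ) * v.1 - x ≤ x ^ ((13 : ℝ) / 17) ∨
    ((m : ℝ) * v.1 - x) * v.2.1 - x * v.1 ≤ x ^ ((28 : ℝ) / 17) / m)}) (by
      rintro ⟨a, b, c, d⟩ ⟨hv, h⟩
      push Not at h
      obtain ⟨-, -, -, -, M, K, hM, hK, e1, i1, -⟩ := S4_facts hn hv
      have i1' : (m : ℝ) * a ≤ 4 * x := by rw [hx]; exact_mod_cast i1
      rcases le_total (Nat.gcd a b : ℝ) (x ^ ((1 : ℝ) / 17)) with hg | hg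
      · exact Or.inl ⟨hv, h.1.le, h.2.le, hg⟩
      · refine Or.inr ⟨hv, ?_, hg⟩
        dsimp only
        linarith)
  refine (u12.union u34 (U := S4 m n) (by
    intro v hv
    by_cases h : ((m : ℝ) * v.1 - x ≤ x ^ ((13 : ℝ) / 17) ∨
      ((m : ℝ) * v.1 - x) * v.2.1 - x * v.1 ≤ x ^ ((28 : ℝ) / 17) / m)
    · exact Or.inl ⟨hv, h⟩
    · exact Or.inr ⟨hv, h⟩)).mono (fun x hx => hx) ?_
  have hΔ2 : Δ ^ 2 ≤ Δ ^ 5 := pow_le_pow_right₀ h0 (by norm_num)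
  set P := x ^ ((28 : ℝ) / 17) / m with hP
  set Q := x ^ ((4 : ℝ) / 3) * (m : ℝ) ^ (-(2 : ℝ) / 3) with hQ
  have hP0 : 0 < P := by positivity
  have hQ0 : 0 < Q := by positivity
  have h12 : (12 : ℝ) ^ ((2 : ℝ) / 3) ≤ 12 := by
    calc (12 : ℝ) ^ ((2 : ℝ) / 3) ≤ 12 ^ (1 : ℝ) :=
          Real.rpow_le_rpow_of_exponent_le (by norm_num) (by norm_num)
      _ = 12 := Real.rpow_one _
  have h3 : (3 : ℝ) ^ ((1 : ℝ) / 3) ≤ 3 := by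
    calc (3 : ℝ) ^ ((1 : ℝ) / 3) ≤ 3 ^ (1 : ℝ) :=
          Real.rpow_le_rpow_of_exponent_le (by norm_num) (by norm_num)
      _ = 3 := Real.rpow_one _
  have hmneg : (m : ℝ) ^ (-(2 : ℝ) / 3) ≤ 1 :=
    Real.rpow_le_one_of_one_le_of_nonpos hmr (by norm_num)
  have bQ : (12 * x ^ 2 / (m * 1)) ^ ((2 : ℝ) / 3) ≤ 12 * Q := by
    have : (12 * x ^ 2 / (m * 1)) ^ ((2 : ℝ) / 3) = 12 ^ ((2 : ℝ) / 3) * Q := by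
      rw [hQ, mul_one, Real.div_rpow (by positivity) hm0.le, Real.mul_rpow (by norm_num)
        (by positivity), neg_div, Real.rpow_neg hm0.le, ← Real.rpow_natCast,
        ← Real.rpow_mul hn0.le]
      norm_num
      ring
    rw [this]; gcongr
  have bQ4 : (12 * x ^ 2 / (m * x ^ ((1 : ℝ) / 17))) ^ ((2 : ℝ) / 3) ≤
      12 * Q * x ^ (-(2 : ℝ) / 51) := by
    have : (12 * x ^ 2 / (m * x ^ ((1 : ℝ) / 17))) ^ ((2 : ℝ) / 3) =
        (12 * x ^ 2 / (m * 1)) ^ ((2 : ℝ) / 3) * x ^ (-(2 : ℝ) / 51) := by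
      have e : 12 * x ^ 2 / (m * x ^ ((1 : ℝ) / 17)) =
          (12 * x ^ 2 / (m * 1)) * x ^ (-(1 : ℝ) / 17) := by
        rw [neg_div, Real.rpow_neg hn0.le]; field_simp
      rw [e, Real.mul_rpow (by positivity) (by positivity), ← Real.rpow_mul hn0.le]
      norm_num
    rw [this]; gcongr
  have c1 : 3 * Δ ^ 5 * (12 * x ^ 2 / (m * 1)) ^ ((2 : ℝ) / 3) *
      (1 + 3 * (x ^ ((13 : ℝ) / 17)) ^ ((1 : ℝ) / 3) / m) ≤ Δ ^ 5 * (36 * Q + 108 * P) := by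
    have hQP : Q * ((x ^ ((13 : ℝ) / 17)) ^ ((1 : ℝ) / 3) / m) ≤ P := by
      have : Q * ((x ^ ((13 : ℝ) / 17)) ^ ((1 : ℝ) / 3) / m) =
          (x ^ ((27 : ℝ) / 17) / m) * (m : ℝ) ^ (-(2 : ℝ) / 3) := by
        have e : x ^ ((27 : ℝ) / 17) = x ^ ((4 : ℝ) / 3) * (x ^ ((13 : ℝ) / 17)) ^ ((1 : ℝ) / 3) := by
          rw [← Real.rpow_mul hn0.le, ← Real.rpow_add hn0]; norm_num
        rw [hQ, e]; ring
      rw [this, hP]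
      have hpw : x ^ ((27 : ℝ) / 17) ≤ x ^ ((28 : ℝ) / 17) :=
        Real.rpow_le_rpow_of_exponent_le hnr (by norm_num)
      calc (x ^ ((27 : ℝ) / 17) / m) * (m : ℝ) ^ (-(2 : ℝ) / 3)
          ≤ (x ^ ((28 : ℝ) / 17) / m) * 1 := by
            apply mul_le_mul _ hmneg (by positivity) (by positivity)
            exact div_le_div_of_nonneg_right hpw hm0.le
        _ = _ := mul_one _
    calc _ ≤ 3 * Δ ^ 5 * (12 * Q) *
      (1 + 3 * (x ^ ((13 : ℝ) / 17)) ^ ((1 : ℝ) / 3) / m) := by gcongr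
      _ = Δ ^ 5 * (36 * Q + 108 * (Q * ((x ^ ((13 : ℝ) / 17)) ^ ((1 : ℝ) / 3) / m))) := by ring
      _ ≤ _ := by gcongr
  have c4 : 3 * Δ ^ 5 * (12 * x ^ 2 / (m * x ^ ((1 : ℝ) / 17))) ^ ((2 : ℝ) / 3) *
      (1 + 3 * (3 * x) ^ ((1 : ℝ) / 3) / m) ≤ Δ ^ 5 * (36 * Q + 324 * P) := by
    have hQP : Q * x ^ (-(2 : ℝ) / 51) * (x ^ ((1 : ℝ) / 3) / m) ≤ P := by
      have : Q * x ^ (-(2 : ℝ) / 51) * (x ^ ((1 : ℝ) / 3) / m) =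
          (x ^ ((83 : ℝ) / 51) / m) * (m : ℝ) ^ (-(2 : ℝ) / 3) := by
        have e : x ^ ((83 : ℝ) / 51) =
            x ^ ((4 : ℝ) / 3) * x ^ (-(2 : ℝ) / 51) * x ^ ((1 : ℝ) / 3) := by
          rw [← Real.rpow_add hn0, ← Real.rpow_add hn0]; norm_num
        rw [hQ, e]; ring
      rw [this, hP]
      have hpw : x ^ ((83 : ℝ) / 51) ≤ x ^ ((28 : ℝ) / 17) :=
        Real.rpow_le_rpow_of_exponent_le hnr (by norm_num)
      calc (x ^ ((83 : ℝ) / 51) / m) * (m : ℝ) ^ (-(2 : ℝ) / 3)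
          ≤ (x ^ ((28 : ℝ) / 17) / m) * 1 := by
            apply mul_le_mul _ hmneg (by positivity) (by positivity)
            exact div_le_div_of_nonneg_right hpw hm0.le
        _ = _ := mul_one _
    have hx1 : x ^ (-(2 : ℝ) / 51) ≤ 1 :=
      Real.rpow_le_one_of_one_le_of_nonpos hnr (by norm_num)
    have h3x : (3 * x) ^ ((1 : ℝ) / 3) ≤ 3 * x ^ ((1 : ℝ) / 3) := by
      rw [Real.mul_rpow (by norm_num) hn0.le]; gcongr
    calc _ ≤ 3 * Δ ^ 5 * (12 * Q * x ^ (-(2 : ℝ) / 51)) *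
      (1 + 3 * (3 * x ^ ((1 : ℝ) / 3)) / m) := by gcongr
      _ = Δ ^ 5 * (36 * (Q * x ^ (-(2 : ℝ) / 51)) +
          324 * (Q * x ^ (-(2 : ℝ) / 51) * (x ^ ((1 : ℝ) / 3) / m))) := by ring
      _ ≤ Δ ^ 5 * (36 * (Q * 1) + 324 * P) := by gcongr
      _ = _ := by ring
  have c3 : 96 * x ^ 4 / (m ^ 2 * x ^ ((13 : ℝ) / 17) * P) * (Δ ^ 5 * x ^ ((1 : ℝ) / 17)) =
      Δ ^ 5 * (96 * P) := by
    have e : x ^ 4 * x ^ ((1 : ℝ) / 17) =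
        x ^ ((13 : ℝ) / 17) * x ^ ((28 : ℝ) / 17) * x ^ ((28 : ℝ) / 17) := by
      rw [← Real.rpow_natCast, ← Real.rpow_add hn0, ← Real.rpow_add hn0, ← Real.rpow_add hn0]
      norm_num
    have hx13 : x ^ ((13 : ℝ) / 17) ≠ 0 := by positivity
    have hPm : P * m = x ^ ((28 : ℝ) / 17) := by rw [hP]; field_simp
    rw [← hPm] at e
    rw [div_mul_eq_mul_div, div_eq_iff (by positivity)]
    linear_combination (96 * Δ ^ 5) * e
  have c2 : P * Δ ^ 2 ≤ Δ ^ 5 * P := by rw [mul_comm]; gcongr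
  rw [c3]
  have hΔQ : 0 ≤ Δ ^ 5 * Q := by positivity
  have hΔP : 0 ≤ Δ ^ 5 * P := by positivity
  nlinarith


/-- The set counted by `numSols 5 m n`. -/
def S5 (m n : ℕ) : Set (Fin 5 → ℕ) :=
  {a | (∀ i, 0 < a i) ∧ Monotone a ∧ (m : ℚ) / n = ∑ i, (1 : ℚ) / a i}

lemma S5_facts {m n : ℕ} (hn : 0 < n) {v : Fin 5 → ℕ} (hv : v ∈ S5 m n) :
    0 < v 0 ∧ n < m * v 0 ∧ m * v 0 ≤ 5 * n ∧
      (v 1, v 2, v 3, v 4) ∈ S4 (m * v 0 - n) (n * v 0) := by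
  obtain ⟨hpos, hmono, h⟩ := hv
  have h01 : v 0 ≤ v 1 := hmono (by decide)
  have h12 : v 1 ≤ v 2 := hmono (by decide)
  have h23 : v 2 ≤ v 3 := hmono (by decide)
  have h34 : v 3 ≤ v 4 := hmono (by decide)
  have p0 := hpos 0
  have p1 := hpos 1
  have p2 := hpos 2
  have p3 := hpos 3
  have p4 := hpos 4
  rw [Fin.sum_univ_five] at h
  clear hpos hmono
  generalize v 0 = a at *
  generalize v 1 = b at *
  generalize v 2 = c at *
  generalize v 3 = d at *
  generalize v 4 = e at *
  have eq : (m * a) * (b * c * d * e) = n * (b * c * d * e) +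
      n * a * (c * d * e + b * d * e + b * c * e + b * c * d) := by
    have hn' : (n : ℚ) ≠ 0 := by exact_mod_cast hn.ne'
    have a' : (a : ℚ) ≠ 0 := by exact_mod_cast p0.ne'
    have b' : (b : ℚ) ≠ 0 := by exact_mod_cast p1.ne'
    have c' : (c : ℚ) ≠ 0 := by exact_mod_cast p2.ne'
    have d' : (d : ℚ) ≠ 0 := by exact_mod_cast p3.ne'
    have e' : (e : ℚ) ≠ 0 := by exact_mod_cast p4.ne'
    have : ((m : ℚ) * a) * (b * c * d * e) = n * (b * c * d * e) +
        n * a * (c * d * e + b * d * e + b * c * e + b * c * d) := by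
      rw [div_eq_iff hn'] at h
      rw [h]
      field_simp
      ring
    exact_mod_cast this
  have h1 : n < m * a := by
    have : n * (b * c * d * e) < (m * a) * (b * c * d * e) := by
      have : 0 < n * a * (c * d * e + b * d * e + b * c * e + b * c * d) := by positivity
      omega
    exact lt_of_mul_lt_mul_right this (by positivity)
  refine ⟨p0, h1, ?_, p1, h12, h23, h34, ?_⟩
  · have : (m * a) * (b * c * d * e) ≤ (5 * n) * (b * c * d * e) := by
      have i1 : a * (c * d * e) ≤ b * (c * d * e) := by gcongr
      have i2 : a * (b * d * e) ≤ c * (b * d * e) := by gcongr; omega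
      have i3 : a * (b * c * e) ≤ d * (b * c * e) := by gcongr; omega
      have i4 : a * (b * c * d) ≤ e * (b * c * d) := by gcongr; omega
      calc (m * a) * (b * c * d * e) = n * (b * c * d * e + a * (c * d * e) + a * (b * d * e)
            + a * (b * c * e) + a * (b * c * d)) := by rw [eq]; ring
        _ ≤ n * (b * c * d * e + b * (c * d * e) + c * (b * d * e)
            + d * (b * c * e) + e * (b * c * d)) := by gcongr
        _ = _ := by ring
    exact le_of_mul_le_mul_right this (by positivity)
  · dsimp only
    obtain ⟨M, hM⟩ := Nat.exists_eq_add_of_le h1.le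
    rw [hM] at eq ⊢
    rw [Nat.add_sub_cancel_left]
    linarith

lemma harm_aux (m n : ℕ) (hm : 0 < m) (I : Finset ℕ)
    (hI : ∀ a ∈ I, n < m * a ∧ m * a ≤ 5 * n) :
    ∑ a ∈ I, 1 / ((m : ℝ) * a - n) ≤ 1 + Real.log (4 * n) := by
  classical
  have h1 : ∑ a ∈ I, 1 / ((m : ℝ) * a - n) = ∑ a ∈ I, 1 / ((m * a - n : ℕ) : ℝ) := by
    apply Finset.sum_congr rfl
    intro a ha
    rw [Nat.cast_sub (hI a ha).1.le]
    push_cast; rfl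
  have h2 : ∑ a ∈ I, 1 / ((m * a - n : ℕ) : ℝ) ≤ ∑ j ∈ Finset.Icc 1 (4 * n), 1 / (j : ℝ) := by
    rw [← Finset.sum_image (f := fun j : ℕ => 1 / (j : ℝ)) (g := fun a => m * a - n) (s := I)]
    · apply Finset.sum_le_sum_of_subset_of_nonneg
      · intro j hj
        obtain ⟨a, ha, rfl⟩ := Finset.mem_image.1 hj
        have := hI a ha
        exact Finset.mem_Icc.2 ⟨by omega, by omega⟩
      · intros; positivity
    · intro a ha b hb hab
      have h3 := hI a ha
      have h4 := hI b hb
      simp only at hab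
      have : m * a = m * b := by omega
      exact Nat.eq_of_mul_eq_mul_left hm this
  have h3 := harmonic_le_one_add_log (4 * n)
  rw [harmonic_eq_sum_Icc] at h3
  push_cast at h3
  rw [h1]
  refine h2.trans ?_
  simpa only [one_div] using h3

lemma F5 {m n Z : ℕ} {Δ : ℝ} (hm : 0 < m) (hn : 0 < n) (hmn : m ≤ 5 * n)
    (hΔ : DivB Z Δ) (hZ : 50000 * (5 * n ^ 2) ^ 12 ≤ Z) :
    Bd (S5 m n) (600 * Δ ^ 5 * ((5 * ((n : ℝ) ^ 2 / m)) ^ ((28 : ℝ) / 17) *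
      (14 + Real.log (4 * n)))) := by
  classical
  have h0 : (1 : ℝ) ≤ Δ := hΔ.1
  have hmr : (1 : ℝ) ≤ m := by exact_mod_cast hm
  have hnr : (1 : ℝ) ≤ n := by exact_mod_cast hn
  have hn0 : (0 : ℝ) < n := by linarith
  have hm0 : (0 : ℝ) < m := by linarith
  have hmn' : (m : ℝ) ≤ 5 * n := by exact_mod_cast hmn
  set X := 5 * ((n : ℝ) ^ 2 / m) with hX
  have hXn : (n : ℝ) ≤ X := by
    rw [hX, ← mul_div_assoc, le_div_iff₀ hm0]
    nlinarith
  have hX1 : 1 ≤ X := hnr.trans hXn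
  set I := (Finset.Icc 1 (5 * n)).filter (fun a => n < m * a ∧ m * a ≤ 5 * n) with hI
  have hI' : ∀ a ∈ I, n < m * a ∧ m * a ≤ 5 * n := fun a ha => (Finset.mem_filter.1 ha).2
  refine (Bd.fiber (fun v => v 0) I (fun a => 600 * Δ ^ 5 *
    (X ^ ((28 : ℝ) / 17) * (1 / ((m : ℝ) * a - n)) +
      X ^ ((4 : ℝ) / 3) * ((m : ℝ) * a - n) ^ (-(2 : ℝ) / 3))) ?_ ?_).mono
      (fun x hx => hx) ?_
  · intro v hv
    obtain ⟨p0, h1, h2, -⟩ := S5_facts hn hv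
    have : v 0 ≤ m * v 0 := Nat.le_mul_of_pos_left _ hm
    exact Finset.mem_filter.2 ⟨Finset.mem_Icc.2 ⟨p0, by omega⟩, h1, h2⟩
  · intro a ha
    obtain ⟨h1, h2⟩ := hI' a ha
    obtain ⟨ha1, ha5⟩ := Finset.mem_Icc.1 (Finset.mem_filter.1 ha).1
    have hM0 : 0 < m * a - n := by omega
    have hMr : ((m * a - n : ℕ) : ℝ) = (m : ℝ) * a - n := by
      rw [Nat.cast_sub h1.le]; push_cast; rfl
    have hf := F4 hM0 (Nat.mul_pos hn ha1) hΔ (by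
      refine le_trans ?_ hZ
      calc 50000 * (n * a) ^ 12 ≤ 50000 * (n * (5 * n)) ^ 12 := by gcongr
        _ = _ := by ring)
    have hN : ((n * a : ℕ) : ℝ) ≤ X := by
      rw [hX, ← mul_div_assoc, le_div_iff₀ hm0]
      have : (m : ℝ) * a ≤ 5 * n := by exact_mod_cast h2
      push_cast
      nlinarith
    have hM1 : (0 : ℝ) < ((m * a - n : ℕ) : ℝ) := by exact_mod_cast hM0
    refine (Bd.inj (S := {x | x ∈ S5 m n ∧ x 0 = a}) (fun v => (v 1, v 2, v 3, v 4)) hf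
      ?_ ?_).mono (fun x hx => hx) ?_
    · rintro v ⟨hv, rfl⟩
      exact (S5_facts hn hv).2.2.2
    · rintro v ⟨hv, h⟩ v' ⟨hv', h'⟩ hvv
      simp only [Prod.mk.injEq] at hvv
      funext i
      fin_cases i
      · exact h.trans h'.symm
      · exact hvv.1
      · exact hvv.2.1
      · exact hvv.2.2.1
      · exact hvv.2.2.2
    · rw [← hMr]
      rw [div_eq_mul_one_div (((n * a : ℕ) : ℝ) ^ ((28 : ℝ) / 17))]
      gcongr
  · rw [← Finset.mul_sum, Finset.sum_add_distrib, ← Finset.mul_sum, ← Finset.mul_sum]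
    have s1 := harm_aux m n hm I hI'
    have s2 := apsum m n hm (4 * n) (by positivity) I (by
      intro a ha
      obtain ⟨h1, h2⟩ := hI' a ha
      have : (m : ℝ) * a ≤ 5 * n := by exact_mod_cast h2
      exact ⟨h1, by linarith⟩)
    have s3 : 1 + 3 * (4 * (n : ℝ)) ^ ((1 : ℝ) / 3) / m ≤ 13 * X ^ ((1 : ℝ) / 6) := by
      have q1 : 1 ≤ X ^ ((1 : ℝ) / 6) := Real.one_le_rpow hX1 (by norm_num)
      have q2 : (4 * (n : ℝ)) ^ ((1 : ℝ) / 3) ≤ 4 * (n : ℝ) ^ ((1 : ℝ) / 3) := by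
        rw [Real.mul_rpow (by norm_num) hn0.le]
        gcongr
        calc (4 : ℝ) ^ ((1 : ℝ) / 3) ≤ 4 ^ (1 : ℝ) :=
              Real.rpow_le_rpow_of_exponent_le (by norm_num) (by norm_num)
          _ = 4 := Real.rpow_one _
      have q3 : (n : ℝ) ^ ((1 : ℝ) / 3) / m ≤ X ^ ((1 : ℝ) / 6) := by
        have r1 : ((n : ℝ) ^ 2 / m) ^ ((1 : ℝ) / 6) =
            (n : ℝ) ^ ((1 : ℝ) / 3) / (m : ℝ) ^ ((1 : ℝ) / 6) := by
          rw [Real.div_rpow (by positivity) hm0.le, ← Real.rpow_natCast, ← Real.rpow_mul hn0.le]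
          norm_num
        have r2 : (m : ℝ) ^ ((1 : ℝ) / 6) ≤ m := by
          calc (m : ℝ) ^ ((1 : ℝ) / 6) ≤ (m : ℝ) ^ (1 : ℝ) :=
                Real.rpow_le_rpow_of_exponent_le hmr (by norm_num)
            _ = m := Real.rpow_one _
        have r3 : (0 : ℝ) ≤ (n : ℝ) ^ 2 / m := by positivity
        calc (n : ℝ) ^ ((1 : ℝ) / 3) / m ≤ (n : ℝ) ^ ((1 : ℝ) / 3) / (m : ℝ) ^ ((1 : ℝ) / 6) := by
              gcongr
          _ = ((n : ℝ) ^ 2 / m) ^ ((1 : ℝ) / 6) := r1.symm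
          _ ≤ X ^ ((1 : ℝ) / 6) := by
              apply Real.rpow_le_rpow r3 _ (by norm_num)
              linarith
      calc 1 + 3 * (4 * (n : ℝ)) ^ ((1 : ℝ) / 3) / m
          ≤ X ^ ((1 : ℝ) / 6) + 3 * (4 * (n : ℝ) ^ ((1 : ℝ) / 3)) / m := by gcongr
        _ = X ^ ((1 : ℝ) / 6) + 12 * ((n : ℝ) ^ ((1 : ℝ) / 3) / m) := by ring
        _ ≤ X ^ ((1 : ℝ) / 6) + 12 * X ^ ((1 : ℝ) / 6) := by gcongr
        _ = _ := by ring
    have s4 : X ^ ((4 : ℝ) / 3) * X ^ ((1 : ℝ) / 6) ≤ X ^ ((28 : ℝ) / 17) := by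
      rw [← Real.rpow_add (by linarith)]
      exact Real.rpow_le_rpow_of_exponent_le hX1 (by norm_num)
    have hX0 : 0 < X := by linarith
    gcongr
    calc X ^ ((28 : ℝ) / 17) * ∑ a ∈ I, 1 / ((m : ℝ) * a - n) +
          X ^ ((4 : ℝ) / 3) * ∑ a ∈ I, ((m : ℝ) * a - n) ^ (-(2 : ℝ) / 3)
        ≤ X ^ ((28 : ℝ) / 17) * (1 + Real.log (4 * n)) +
          X ^ ((4 : ℝ) / 3) * (13 * X ^ ((1 : ℝ) / 6)) := by
          apply add_le_add
          · exact mul_le_mul_of_nonneg_left s1 (by positivity)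
          · exact mul_le_mul_of_nonneg_left (s2.trans s3) (by positivity)
      _ ≤ X ^ ((28 : ℝ) / 17) * (14 + Real.log (4 * n)) := by linarith

theorem stmt_18 : ∀ ε : ℝ, 0 < ε → ∃ C : ℝ, 0 < C ∧
    ∀ m n : ℕ, 0 < m → 0 < n →
      (numSols 5 m n : ℝ) ≤ C * (n : ℝ) ^ ε * ((n : ℝ) ^ 2 / (m : ℝ)) ^ ((28 : ℝ) / 17) := by
  intro ε hε
  set δ := ε / 240 with hδ
  have hδ0 : 0 < δ := by positivity
  obtain ⟨C, hC1, hC⟩ := divisor_bound δ hδ0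
  set η := ε / 2 with hη
  have hη0 : 0 < η := by positivity
  set H : ℝ := 14 + 4 ^ η / η with hH
  have hH0 : 0 < H := by positivity
  set W : ℝ := 50000 * 5 ^ 12 with hW
  have hW0 : 0 < W := by positivity
  refine ⟨600 * (C * W ^ δ) ^ 5 * ((5 : ℝ) ^ ((28 : ℝ) / 17) * H), by positivity, ?_⟩
  intro m n hm hn
  have hmr : (1 : ℝ) ≤ m := by exact_mod_cast hm
  have hnr : (1 : ℝ) ≤ n := by exact_mod_cast hn
  have hn0 : (0 : ℝ) < n := by linarith
  have hm0 : (0 : ℝ) < m := by linarith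
  suffices hb : Bd (S5 m n) (600 * (C * W ^ δ) ^ 5 * ((5 : ℝ) ^ ((28 : ℝ) / 17) * H) *
      (n : ℝ) ^ ε * ((n : ℝ) ^ 2 / (m : ℝ)) ^ ((28 : ℝ) / 17)) by
    have e : numSols 5 m n = Set.ncard (S5 m n) := rfl
    rw [e]
    by_cases hfin : (S5 m n).Finite
    · rw [Set.ncard_eq_toFinset_card _ hfin]
      apply hb
      intro x hx
      exact hfin.mem_toFinset.1 hx
    · rw [Set.Infinite.ncard hfin]
      simp only [Nat.cast_zero]
      positivity
  by_cases hmn : m ≤ 5 * n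
  swap
  · intro F hF
    have : F = ∅ := by
      apply Finset.eq_empty_of_forall_notMem
      intro v hv
      obtain ⟨h1, h2, h3, -⟩ := S5_facts hn (hF _ hv)
      have : m ≤ m * v 0 := Nat.le_mul_of_pos_right _ h1
      omega
    rw [this]
    simp only [Finset.card_empty, Nat.cast_zero]
    positivity
  set Z := 50000 * (5 * n ^ 2) ^ 12 with hZ
  have hZr : (Z : ℝ) = W * (n : ℝ) ^ 24 := by rw [hZ, hW]; push_cast; ring
  have hZ1 : (1 : ℝ) ≤ Z := by
    have : 0 < Z := by positivity
    exact_mod_cast this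
  have hΔ : DivB Z (C * (Z : ℝ) ^ δ) := by
    refine ⟨?_, ?_⟩
    · have : 1 ≤ (Z : ℝ) ^ δ := Real.one_le_rpow hZ1 hδ0.le
      nlinarith
    · intro k hk hkZ
      refine (hC k hk).trans ?_
      gcongr
  refine (F5 hm hn hmn hΔ le_rfl).mono (fun x hx => hx) ?_
  have e1 : (C * (Z : ℝ) ^ δ) ^ 5 = (C * W ^ δ) ^ 5 * (n : ℝ) ^ η := by
    have : ((n : ℝ) ^ η) = (((n : ℝ) ^ 24) ^ δ) ^ 5 := by
      rw [← Real.rpow_natCast, ← Real.rpow_natCast, ← Real.rpow_mul hn0.le,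
        ← Real.rpow_mul hn0.le]
      congr 1
      rw [hη, hδ]; push_cast; ring
    rw [this, hZr, Real.mul_rpow hW0.le (by positivity)]
    ring
  have e2 : (n : ℝ) ^ ε = (n : ℝ) ^ η * (n : ℝ) ^ η := by
    rw [← Real.rpow_add hn0]; congr 1; rw [hη]; ring
  have e3 : (5 * ((n : ℝ) ^ 2 / m)) ^ ((28 : ℝ) / 17) =
      5 ^ ((28 : ℝ) / 17) * ((n : ℝ) ^ 2 / m) ^ ((28 : ℝ) / 17) :=
    Real.mul_rpow (by norm_num) (by positivity)
  have e4 : 14 + Real.log (4 * n) ≤ H * (n : ℝ) ^ η := by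
    have q1 := Real.log_le_rpow_div (x := 4 * (n : ℝ)) (by positivity) hη0
    rw [Real.mul_rpow (by norm_num) hn0.le] at q1
    have q2 : 1 ≤ (n : ℝ) ^ η := Real.one_le_rpow hnr hη0.le
    have q3 : H * (n : ℝ) ^ η = 14 * (n : ℝ) ^ η + 4 ^ η * (n : ℝ) ^ η / η := by rw [hH]; ring
    linarith
  rw [e1, e2, e3]
  calc _ ≤ 600 * ((C * W ^ δ) ^ 5 * (n : ℝ) ^ η) *
      (5 ^ ((28 : ℝ) / 17) * ((n : ℝ) ^ 2 / m) ^ ((28 : ℝ) / 17) * (H * (n : ℝ) ^ η)) := by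
        gcongr
    _ = _ := by ring
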